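/- arXiv:2408.13258 — 2 statements merged into one kernel-verified Lean document; each statement's English description precedes it below -/
import Mathlib

section
/- Let g be in normal form and let ν₀ = (0, y₀, z₀) ∈ ℝ³ be a unit vector. Then the height function h_{ν₀} has an A₁ singularity at (0,0) if and only if y₀·(b₂ y₀ + a_{2,0} z₀) ≠ 0. -/
open Real Set

noncomputable section

/-- Partial derivative in the first variable. -/
def pdu {F : Type*} [NormedAddCommGroup F] [NormedSpace ℝ F] (f : ℝ → ℝ → F) : ℝ → ℝ → F :=
  fun u w => deriv (fun t => f t w) u

/-- Partial derivative in the second variable. -/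
def pdw {F : Type*} [NormedAddCommGroup F] [NormedSpace ℝ F] (f : ℝ → ℝ → F) : ℝ → ℝ → F :=
  fun u w => deriv (fun t => f u t) w

/-- Iterated partial derivative `∂_u^i ∂_w^j f`. -/
def pd {F : Type*} [NormedAddCommGroup F] [NormedSpace ℝ F] (i j : ℕ) (f : ℝ → ℝ → F) :
    ℝ → ℝ → F :=
  pdu^[i] (pdw^[j] f)

/-- The Euclidean inner product on `ℝ³ = ℝ × ℝ × ℝ`. -/
def dot3 (x y : ℝ × ℝ × ℝ) : ℝ := x.1 * y.1 + x.2.1 * y.2.1 + x.2.2 * y.2.2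

/-- The cross product on `ℝ³ = ℝ × ℝ × ℝ`. -/
def cross3 (x y : ℝ × ℝ × ℝ) : ℝ × ℝ × ℝ :=
  (x.2.1 * y.2.2 - x.2.2 * y.2.1, x.2.2 * y.1 - x.1 * y.2.2, x.1 * y.2.1 - x.2.1 * y.1)

/-- The Euclidean norm on `ℝ³ = ℝ × ℝ × ℝ`. -/
def norm3 (x : ℝ × ℝ × ℝ) : ℝ := Real.sqrt (dot3 x x)

/-- The surface parameterization `g(u,w) = (u, p(u,w), q(u,w))`. -/
def gmap (p q : ℝ → ℝ → ℝ) : ℝ → ℝ → ℝ × ℝ × ℝ := fun u w => (u, p u w, q u w)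

/-- The height function on the surface parameterized by `g = (u, p, q)` along `v`. -/
def hgt (p q : ℝ → ℝ → ℝ) (v : ℝ × ℝ × ℝ) : ℝ → ℝ → ℝ :=
  fun u w => dot3 (gmap p q u w) v

/-- `g = (u, p(u,w), q(u,w))` is in normal form of order `N`. -/
def NormalFormN (N : ℕ) (p q : ℝ → ℝ → ℝ) (b : ℕ → ℝ) (a : ℕ → ℕ → ℝ) : Prop :=
  ContDiff ℝ (⊤ : ℕ∞) (fun x : ℝ × ℝ => p x.1 x.2) ∧
  ContDiff ℝ (⊤ : ℕ∞) (fun x : ℝ × ℝ => q x.1 x.2) ∧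
  p 0 0 = 0 ∧ q 0 0 = 0 ∧
  pd 1 0 p 0 0 = 0 ∧ pd 0 1 p 0 0 = 0 ∧ pd 1 0 q 0 0 = 0 ∧ pd 0 1 q 0 0 = 0 ∧
  pd 0 2 p 0 0 = 1 ∧
  (∀ i, 2 ≤ i → i ≤ N → pd i 0 p 0 0 = b i) ∧
  (∀ i j, 2 ≤ i + j → i + j ≤ N → 1 ≤ j → ¬(i = 0 ∧ j = 2) → pd i j p 0 0 = 0) ∧
  (∀ i j, 2 ≤ i + j → i + j ≤ N → pd i j q 0 0 = a i j) ∧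
  a 1 1 = 0 ∧ a 0 2 = 0

/-- `h` has an `A_k` singularity at the origin: up to a `C^∞` change of coordinates fixing
the origin, `h` equals `h(0,0) ± x² ± y^(k+1)`. -/
def HasAkSingAt (h : ℝ → ℝ → ℝ) (k : ℕ) : Prop :=
  ∃ (U V : Set (ℝ × ℝ)) (φ ψ : ℝ × ℝ → ℝ × ℝ) (ε₁ ε₂ : ℝ),
    IsOpen U ∧ IsOpen V ∧ ((0, 0) : ℝ × ℝ) ∈ U ∧ ((0, 0) : ℝ × ℝ) ∈ V ∧
    ContDiffOn ℝ (⊤ : ℕ∞) φ U ∧ ContDiffOn ℝ (⊤ : ℕ∞) ψ V ∧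
    Set.MapsTo φ U V ∧ Set.MapsTo ψ V U ∧
    (∀ x ∈ U, ψ (φ x) = x) ∧ (∀ y ∈ V, φ (ψ y) = y) ∧
    φ (0, 0) = (0, 0) ∧ (ε₁ = 1 ∨ ε₁ = -1) ∧ (ε₂ = 1 ∨ ε₂ = -1) ∧
    ∀ x ∈ U, h (φ x).1 (φ x).2 = h 0 0 + ε₁ * x.1 ^ 2 + ε₂ * x.2 ^ (k + 1)

/-- The parabolic-set function `Σ = ⟨g_uu, g_u × g_w⟩⟨g_ww, g_u × g_w⟩ − ⟨g_uw, g_u × g_w⟩²`. -/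
def SigmaFun (p q : ℝ → ℝ → ℝ) : ℝ → ℝ → ℝ := fun u w =>
  dot3 (pd 2 0 (gmap p q) u w) (cross3 (pd 1 0 (gmap p q) u w) (pd 0 1 (gmap p q) u w)) *
      dot3 (pd 0 2 (gmap p q) u w) (cross3 (pd 1 0 (gmap p q) u w) (pd 0 1 (gmap p q) u w)) -
    dot3 (pd 1 1 (gmap p q) u w) (cross3 (pd 1 0 (gmap p q) u w) (pd 0 1 (gmap p q) u w)) ^ 2

/-- The torsion of a space curve `L`. -/
def tor (L : ℝ → ℝ × ℝ × ℝ) : ℝ → ℝ := fun t =>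
  dot3 (cross3 (deriv L t) (deriv (deriv L) t)) (deriv (deriv (deriv L)) t) /
    norm3 (cross3 (deriv L t) (deriv (deriv L) t)) ^ 2

/-- The unit binormal vector of a space curve `L` at `t = 0`. -/
def binormal0 (L : ℝ → ℝ × ℝ × ℝ) : ℝ × ℝ × ℝ :=
  (norm3 (cross3 (deriv L 0) (deriv (deriv L) 0)))⁻¹ • cross3 (deriv L 0) (deriv (deriv L) 0)

/-- `f` is a parabolic Monge form with `∂_w² f(0,0) = k₂ ≠ 0`. -/
def MongeForm (f : ℝ → ℝ → ℝ) (k₂ : ℝ) : Prop :=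
  ContDiff ℝ (⊤ : ℕ∞) (fun x : ℝ × ℝ => f x.1 x.2) ∧ f 0 0 = 0 ∧
  pd 1 0 f 0 0 = 0 ∧ pd 0 1 f 0 0 = 0 ∧
  pd 2 0 f 0 0 = 0 ∧ pd 1 1 f 0 0 = 0 ∧ pd 0 2 f 0 0 = k₂ ∧ k₂ ≠ 0

/-- The parabolic-set function `P = f_uu f_ww − f_uw²` of a Monge form. -/
def Pfun (f : ℝ → ℝ → ℝ) : ℝ → ℝ → ℝ := fun u w =>
  pd 2 0 f u w * pd 0 2 f u w - pd 1 1 f u w ^ 2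

open Filter Topology
open scoped ContDiff

/-- A parametric interval integral of a jointly `C^n` function is `C^n` in the parameter. -/
theorem contDiff_nat_parametric_intervalIntegral.{u} {E : Type u} [NormedAddCommGroup E]
    [NormedSpace ℝ E] [ProperSpace E] (a b : ℝ) (n : ℕ) :
    ∀ {G : Type u} [NormedAddCommGroup G] [NormedSpace ℝ G] {F : E × ℝ → G},
      ContDiff ℝ n F → ContDiff ℝ n (fun x => ∫ t in a..b, F (x, t)) := by
  induction n with
  | zero =>
    intro G _ _ F hF
    have hc : Continuous F := hF.continuous
    exact contDiff_zero.2
      (intervalIntegral.continuous_parametric_intervalIntegral_of_continuous'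
        (f := fun x t => F (x, t)) hc a b)
  | succ n ih =>
    intro G _ _ F hF
    have hF1 : ContDiff ℝ n (fderiv ℝ F) := hF.fderiv_right (by simp)
    set D : E × ℝ → (E →L[ℝ] G) :=
      fun z => (fderiv ℝ F z).comp (ContinuousLinearMap.inl ℝ E ℝ) with hD
    have hDn : ContDiff ℝ n D := hF1.clm_comp contDiff_const
    have hDc : Continuous D := hDn.continuous
    have hFc : Continuous F := hF.continuous
    rw [Nat.cast_add, Nat.cast_one, contDiff_succ_iff_hasFDerivAt]
    refine ⟨fun x => ∫ t in a..b, D (x, t), ih hDn, fun x₀ => ?_⟩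
    obtain ⟨C, hC⟩ := ((isCompact_closedBall x₀ 1).prod
      (isCompact_uIcc (a := a) (b := b))).exists_bound_of_continuousOn hDc.continuousOn
    refine intervalIntegral.hasFDerivAt_integral_of_dominated_of_fderiv_le
      (F := fun x t => F (x, t)) (F' := fun x t => D (x, t)) (bound := fun _ => C)
      (Metric.closedBall_mem_nhds x₀ one_pos) ?_ ?_ ?_ ?_ ?_ ?_
    · exact Eventually.of_forall fun x =>
        (hFc.comp (by fun_prop : Continuous fun t : ℝ => (x, t))).aestronglyMeasurable
    · exact (hFc.comp (by fun_prop : Continuous fun t : ℝ => (x₀, t))).intervalIntegrable _ _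
    · exact (hDc.comp (by fun_prop : Continuous fun t : ℝ => (x₀, t))).aestronglyMeasurable
    · exact Eventually.of_forall fun t ht x hx => hC (x, t) ⟨hx, uIoc_subset_uIcc ht⟩
    · exact intervalIntegrable_const
    · refine Eventually.of_forall fun t _ x _ => ?_
      have h1 : HasFDerivAt F (fderiv ℝ F (x, t)) (x, t) :=
        (hF.differentiable (by simp) (x, t)).hasFDerivAt
      exact h1.comp x (hasFDerivAt_prodMk_left x t)

/-- Hadamard's lemma in the plane. -/
theorem exists_eq_fst_mul_add_snd_mul {F : ℝ × ℝ → ℝ} (hF : ContDiff ℝ ∞ F) (h0 : F 0 = 0) :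
    ∃ f g : ℝ × ℝ → ℝ, ContDiff ℝ ∞ f ∧ ContDiff ℝ ∞ g ∧
      ∀ x, F x = x.1 * f x + x.2 * g x := by
  have hF' : ContDiff ℝ ∞ (fderiv ℝ F) := hF.fderiv_right (by simp)
  have key : ∀ v : ℝ × ℝ, ContDiff ℝ ∞ (fun z : (ℝ × ℝ) × ℝ => fderiv ℝ F (z.2 • z.1) v) :=
    fun v => (hF'.comp (contDiff_snd.smul contDiff_fst)).clm_apply contDiff_const
  have smooth : ∀ v : ℝ × ℝ, ContDiff ℝ ∞ (fun x : ℝ × ℝ => ∫ t in (0 : ℝ)..1,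
      fderiv ℝ F (t • x) v) := fun v => contDiff_infty.2 fun n =>
    contDiff_nat_parametric_intervalIntegral 0 1 n (contDiff_infty.1 (key v) n)
  refine ⟨_, _, smooth (1, 0), smooth (0, 1), fun x => ?_⟩
  have cont : ∀ v : ℝ × ℝ, Continuous fun t : ℝ => fderiv ℝ F (t • x) v := fun v =>
    (key v).continuous.comp (by fun_prop : Continuous fun t : ℝ => (x, t))
  have hderiv : ∀ t ∈ uIcc (0 : ℝ) 1,
      HasDerivAt (fun t : ℝ => F (t • x)) (fderiv ℝ F (t • x) x) t := by
    intro t _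
    have h1 : HasFDerivAt F (fderiv ℝ F (t • x)) (t • x) :=
      (hF.differentiable (by simp) _).hasFDerivAt
    have h2 : HasDerivAt (fun t : ℝ => t • x) x t := by
      simpa using (hasDerivAt_id t).smul_const x
    exact h1.comp_hasDerivAt t h2
  have ftc := intervalIntegral.integral_eq_sub_of_hasDerivAt hderiv ((cont x).intervalIntegrable _ _)
  simp only [one_smul, zero_smul, h0, sub_zero] at ftc
  rw [← ftc, ← intervalIntegral.integral_const_mul, ← intervalIntegral.integral_const_mul,
    ← intervalIntegral.integral_add (((cont _).const_mul _).intervalIntegrable _ _)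
      (((cont _).const_mul _).intervalIntegrable _ _)]
  refine intervalIntegral.integral_congr fun t _ => ?_
  have hx : x = x.1 • ((1, 0) : ℝ × ℝ) + x.2 • ((0, 1) : ℝ × ℝ) := by ext <;> simp
  have hsplit := congrArg (fderiv ℝ F (t • x)) hx
  rwa [map_add, map_smul, map_smul, smul_eq_mul, smul_eq_mul] at hsplit

/-- A function `s ↦ c s * s` has derivative `c 0` at the origin when `c` is continuous there. -/
theorem hasDerivAt_mul_self_zero {c : ℝ → ℝ} (hc : ContinuousAt c 0) :
    HasDerivAt (fun s => c s * s) (c 0) 0 := by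
  rw [hasDerivAt_iff_tendsto_slope]
  refine (hc.tendsto.mono_left nhdsWithin_le_nhds).congr' ?_
  filter_upwards [self_mem_nhdsWithin] with s hs
  have : s ≠ 0 := hs
  simp [slope_def_field, this]

/-- The second derivative of `s ↦ c s * s ^ 2` at the origin. -/
theorem deriv_deriv_mul_sq_zero {c : ℝ → ℝ} (hc : ContDiff ℝ ∞ c) :
    deriv (fun t => deriv (fun s => c s * s ^ 2) t) 0 = 2 * c 0 := by
  have h1 : (fun t => deriv (fun s => c s * s ^ 2) t) =
      fun t => (deriv c t * t + 2 * c t) * t := by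
    funext t
    have := ((hc.differentiable (by simp) t).hasDerivAt.mul (hasDerivAt_pow 2 t)).deriv
    refine this.trans ?_
    simp
    ring
  have h2 : Continuous (deriv c) := hc.continuous_deriv (by simp)
  have h3 := hc.continuous
  rw [h1, (hasDerivAt_mul_self_zero (c := fun t => deriv c t * t + 2 * c t)
    (by fun_prop : Continuous _).continuousAt).deriv]
  simp

/-- A function with a critical point of value zero at the origin is a quadratic form with smooth
coefficients, whose values at the origin are given by the second-order partial derivatives. -/
theorem exists_quadratic_form {f : ℝ → ℝ → ℝ} (hf : ContDiff ℝ ∞ fun x : ℝ × ℝ => f x.1 x.2)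
    (h0 : f 0 0 = 0) (hu : pd 1 0 f 0 0 = 0) (hw : pd 0 1 f 0 0 = 0) :
    ∃ k m l : ℝ × ℝ → ℝ, ContDiff ℝ ∞ k ∧ ContDiff ℝ ∞ m ∧ ContDiff ℝ ∞ l ∧
      (∀ u w, f u w = k (u, w) * u ^ 2 + m (u, w) * u * w + l (u, w) * w ^ 2) ∧
      pd 2 0 f 0 0 = 2 * k 0 ∧ pd 1 1 f 0 0 = m 0 ∧ pd 0 2 f 0 0 = 2 * l 0 := by
  have cu : ContDiff ℝ ∞ fun t : ℝ => (t, (0 : ℝ)) := contDiff_id.prodMk contDiff_const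
  have cw : ContDiff ℝ ∞ fun t : ℝ => ((0 : ℝ), t) := contDiff_const.prodMk contDiff_id
  obtain ⟨f₁, f₂, hf₁, hf₂, hfe⟩ := exists_eq_fst_mul_add_snd_mul hf h0
  have e₁ : f₁ 0 = 0 := by
    have h : (fun t => f t 0) = fun t => f₁ (t, 0) * t := by
      funext t; simpa [mul_comm] using hfe (t, 0)
    have h' := (hasDerivAt_mul_self_zero (c := fun t => f₁ (t, 0))
      (hf₁.comp cu).continuous.continuousAt).deriv
    rw [← h] at h'
    exact h'.symm.trans hu
  have e₂ : f₂ 0 = 0 := by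
    have h : (fun t => f 0 t) = fun t => f₂ (0, t) * t := by
      funext t; simpa [mul_comm] using hfe (0, t)
    have h' := (hasDerivAt_mul_self_zero (c := fun t => f₂ (0, t))
      (hf₂.comp cw).continuous.continuousAt).deriv
    rw [← h] at h'
    exact h'.symm.trans hw
  obtain ⟨k, m₁, hk, hm₁, hke⟩ := exists_eq_fst_mul_add_snd_mul hf₁ e₁
  obtain ⟨m₂, l, hm₂, hl, hle⟩ := exists_eq_fst_mul_add_snd_mul hf₂ e₂
  have hq : ∀ u w, f u w =
      k (u, w) * u ^ 2 + (m₁ (u, w) + m₂ (u, w)) * u * w + l (u, w) * w ^ 2 := by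
    intro u w
    have h := hfe (u, w)
    rw [hke, hle] at h
    simp only at h
    rw [h]
    ring
  refine ⟨k, fun x => m₁ x + m₂ x, l, hk, hm₁.add hm₂, hl, hq, ?_, ?_, ?_⟩
  · have h : (fun s => f s 0) = fun s => k (s, 0) * s ^ 2 := by
      funext s; simp [hq]
    have h' := deriv_deriv_mul_sq_zero (hk.comp cu)
    simp only [Function.comp_def] at h'
    rw [← h] at h'
    exact h'
  · have hd : ∀ t : ℝ, deriv (fun s => f t s) 0 =
        (fderiv ℝ k (t, 0) (0, 1) * t + (m₁ (t, 0) + m₂ (t, 0))) * t := by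
      intro t
      have hps : HasDerivAt (fun s : ℝ => (t, s)) ((0 : ℝ), (1 : ℝ)) 0 :=
        (hasDerivAt_const 0 t).prodMk (hasDerivAt_id 0)
      have d1 : HasDerivAt (fun s => k (t, s)) (fderiv ℝ k (t, 0) (0, 1)) 0 :=
        (hk.differentiable (by simp) (t, 0)).hasFDerivAt.comp_hasDerivAt 0 hps
      have hc : Continuous fun s => (m₁ (t, s) + m₂ (t, s)) * t + l (t, s) * s := by
        have := hm₁.continuous; have := hm₂.continuous; have := hl.continuous
        fun_prop
      have d2 := hasDerivAt_mul_self_zero hc.continuousAt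
      have d3 := ((d1.mul_const (t ^ 2)).add d2).deriv
      have he : (fun s => f t s) = (fun s => k (t, s) * t ^ 2) +
          fun s => ((m₁ (t, s) + m₂ (t, s)) * t + l (t, s) * s) * s := by
        funext s; simp only [hq, Pi.add_apply]; ring
      rw [he, d3]; ring
    have hc : Continuous fun t : ℝ =>
        fderiv ℝ k (t, 0) (0, 1) * t + (m₁ (t, 0) + m₂ (t, 0)) := by
      have := hm₁.continuous; have := hm₂.continuous
      have := hk.continuous_fderiv (by simp)
      fun_prop
    have h' := (hasDerivAt_mul_self_zero hc.continuousAt).deriv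
    have : pd 1 1 f 0 0 = deriv (fun t => deriv (fun s => f t s) 0) 0 := rfl
    rw [this, funext hd, h', mul_zero, zero_add]
    rfl
  · have h : (fun s => f 0 s) = fun s => l (0, s) * s ^ 2 := by
      funext s; simp [hq]
    have h' := deriv_deriv_mul_sq_zero (hl.comp cw)
    simp only [Function.comp_def] at h'
    rw [← h] at h'
    exact h'

/-- The inverse function theorem for `C^∞` maps, with an inverse that is `C^∞` on an open set. -/
theorem exists_contDiffOn_local_inverse {E F : Type*} [NormedAddCommGroup E] [NormedSpace ℝ E]
    [CompleteSpace E] [NormedAddCommGroup F] [NormedSpace ℝ F] {f : E → F} {a : E}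
    {f' : E ≃L[ℝ] F} (hf : ∀ᶠ x in 𝓝 a, ContDiffAt ℝ ∞ f x)
    (hf' : HasFDerivAt f (f' : E →L[ℝ] F) a) {P : E → Prop} (hP : ∀ᶠ x in 𝓝 a, P x) :
    ∃ (V : Set E) (U : Set F) (g : F → E), IsOpen V ∧ IsOpen U ∧ a ∈ V ∧ f a ∈ U ∧
      ContDiffOn ℝ ∞ f V ∧ ContDiffOn ℝ ∞ g U ∧ MapsTo f V U ∧ MapsTo g U V ∧
      (∀ x ∈ V, g (f x) = x) ∧ (∀ y ∈ U, f (g y) = y) ∧ ∀ x ∈ V, P x := by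
  have hfa : ContDiffAt ℝ ∞ f a := hf.self_of_nhds
  let e := hfa.toOpenPartialHomeomorph f hf' (by simp)
  have hsrc : ∀ᶠ x in 𝓝 a, x ∈ e.source :=
    e.open_source.mem_nhds (hfa.mem_toOpenPartialHomeomorph_source hf' (by simp))
  have hinv : ∀ᶠ x in 𝓝 a, ∃ L : E ≃L[ℝ] F, (L : E →L[ℝ] F) = fderiv ℝ f x := by
    have hc : ContinuousAt (fderiv ℝ f) a := (hfa.fderiv_right (m := ∞) (by simp)).continuousAt
    have hn := ContinuousLinearEquiv.nhds f'
    rw [← hf'.fderiv] at hn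
    exact hc hn
  obtain ⟨V, hV, hVo, haV⟩ := eventually_nhds_iff.1 (hf.and (hP.and (hsrc.and hinv)))
  have hVs : V ⊆ e.source := fun x hx => (hV x hx).2.2.1
  refine ⟨V, f '' V, e.symm, hVo, e.isOpen_image_of_subset_source hVo hVs, haV,
    mem_image_of_mem f haV, fun x hx => (hV x hx).1.contDiffWithinAt, ?_, mapsTo_image f V, ?_,
    fun x hx => e.left_inv (hVs hx), ?_, fun x hx => (hV x hx).2.1⟩
  · rintro _ ⟨x, hx, rfl⟩
    obtain ⟨hx1, -, hx2, L, hL⟩ := hV x hx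
    have hs : e.symm (f x) = x := e.left_inv hx2
    refine (e.contDiffAt_symm (f₀' := L) (a := f x) (e.map_source hx2) ?_ ?_).contDiffWithinAt
    · rw [hs, hL]
      exact (hx1.differentiableAt (by simp)).hasFDerivAt
    · rw [hs]; exact hx1
  · rintro _ ⟨x, hx, rfl⟩
    have hs : e.symm (f x) = x := e.left_inv (hVs hx)
    rwa [hs]
  · rintro _ ⟨x, hx, rfl⟩
    exact e.right_inv (e.map_source (hVs hx))

/-- An invertible diagonal linear map of the plane. -/
def diagEquiv (α β : ℝ) (hα : α ≠ 0) (hβ : β ≠ 0) : (ℝ × ℝ) ≃L[ℝ] (ℝ × ℝ) :=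
  ContinuousLinearEquiv.equivOfInverse
    ((α • ContinuousLinearMap.fst ℝ ℝ ℝ).prod (β • ContinuousLinearMap.snd ℝ ℝ ℝ))
    ((α⁻¹ • ContinuousLinearMap.fst ℝ ℝ ℝ).prod (β⁻¹ • ContinuousLinearMap.snd ℝ ℝ ℝ))
    (fun x => by ext <;> simp [hα, hβ]) (fun x => by ext <;> simp [hα, hβ])

theorem exists_sign_mul_pos {r : ℝ} (hr : r ≠ 0) : ∃ ε : ℝ, (ε = 1 ∨ ε = -1) ∧ 0 < ε * r := by
  rcases lt_or_gt_of_ne hr with h | h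
  · exact ⟨-1, Or.inr rfl, by linarith⟩
  · exact ⟨1, Or.inl rfl, by linarith⟩

/-- The Morse lemma in the plane, for a diagonal nondegenerate Hessian. -/
theorem hasAkSingAt_one_of_quadratic_form {h : ℝ → ℝ → ℝ} {k m l : ℝ × ℝ → ℝ}
    (hk : ContDiff ℝ ∞ k) (hm : ContDiff ℝ ∞ m) (hl : ContDiff ℝ ∞ l)
    (hh : ∀ u w, h u w = k (u, w) * u ^ 2 + m (u, w) * u * w + l (u, w) * w ^ 2)
    (hm0 : m 0 = 0) (hk0 : k 0 ≠ 0) (hl0 : l 0 ≠ 0) : HasAkSingAt h 1 := by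
  obtain ⟨ε₁, hε₁, hk1⟩ := exists_sign_mul_pos hk0
  obtain ⟨ε₂, hε₂, hl1⟩ := exists_sign_mul_pos hl0
  have sq₁ : ε₁ * ε₁ = 1 := by rcases hε₁ with rfl | rfl <;> norm_num
  have sq₂ : ε₂ * ε₂ = 1 := by rcases hε₂ with rfl | rfl <;> norm_num
  set n : ℝ × ℝ → ℝ := fun x => m x / (2 * l x) with hn
  set c : ℝ × ℝ → ℝ := fun x => ε₁ * (k x - m x * n x / 2) with hc
  set d : ℝ × ℝ → ℝ := fun x => ε₂ * l x with hd
  have hn0 : n 0 = 0 := by simp [hn, hm0]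
  have hc0 : c 0 = ε₁ * k 0 := by simp [hc, hm0]
  have hnC : ∀ x, l x ≠ 0 → ContDiffAt ℝ ∞ n x := fun x hx =>
    hm.contDiffAt.div (contDiff_const.mul hl).contDiffAt (by simpa using hx)
  have hcC : ∀ x, l x ≠ 0 → ContDiffAt ℝ ∞ c x := fun x hx =>
    contDiffAt_const.mul (hk.contDiffAt.sub ((hm.contDiffAt.mul (hnC x hx)).div_const 2))
  have hdC : ContDiff ℝ ∞ d := contDiff_const.mul hl
  set ψ : ℝ × ℝ → ℝ × ℝ :=
    fun x => (Real.sqrt (c x) * x.1, Real.sqrt (d x) * (x.2 + n x * x.1)) with hψ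
  have hP : ∀ᶠ x in 𝓝 (0 : ℝ × ℝ), 0 < c x ∧ 0 < d x := by
    refine ((hcC 0 hl0).continuousAt.eventually (lt_mem_nhds ?_)).and
      (hdC.continuous.continuousAt.eventually (lt_mem_nhds hl1))
    rw [hc0]; exact hk1
  have hlne : ∀ x, 0 < d x → l x ≠ 0 := fun x hx h0 => by simp [hd, h0] at hx
  have hψC : ∀ x, 0 < c x → 0 < d x → ContDiffAt ℝ ∞ ψ x := fun x hx hx' =>
    (((hcC x (hlne x hx')).sqrt hx.ne').mul contDiffAt_fst).prodMk
      ((hdC.contDiffAt.sqrt hx'.ne').mul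
        (contDiffAt_snd.add ((hnC x (hlne x hx')).mul contDiffAt_fst)))
  have hc0' : 0 < c 0 := hc0 ▸ hk1
  have hψ' : HasFDerivAt ψ (diagEquiv (Real.sqrt (c 0)) (Real.sqrt (d 0))
      (Real.sqrt_pos.2 hc0').ne' (Real.sqrt_pos.2 hl1).ne' : ℝ × ℝ →L[ℝ] ℝ × ℝ) 0 := by
    have h1 := (((hcC 0 hl0).sqrt hc0'.ne').differentiableAt (by simp)).hasFDerivAt
    have h2 := ((hdC.contDiffAt.sqrt (x := 0) hl1.ne').differentiableAt (by simp)).hasFDerivAt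
    have h3 := ((hnC 0 hl0).differentiableAt (by simp)).hasFDerivAt
    have hfst : HasFDerivAt (fun x : ℝ × ℝ => x.1) (ContinuousLinearMap.fst ℝ ℝ ℝ) 0 :=
      hasFDerivAt_fst
    have hsnd : HasFDerivAt (fun x : ℝ × ℝ => x.2) (ContinuousLinearMap.snd ℝ ℝ ℝ) 0 :=
      hasFDerivAt_snd
    refine ((h1.mul hfst).prodMk (h2.mul (hsnd.add (h3.mul hfst)))).congr_fderiv ?_
    ext <;> simp [diagEquiv, hn0]
  obtain ⟨V, U, φ, hVo, hUo, h0V, h0U, hψV, hφU, hmap, hmap', hl', hr', hVP⟩ :=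
    exists_contDiffOn_local_inverse (hP.mono fun x hx => hψC x hx.1 hx.2) hψ' hP
  have hψ0 : ψ 0 = 0 := by simp [hψ]
  rw [hψ0] at h0U
  refine ⟨U, V, φ, ψ, ε₁, ε₂, hUo, hVo, h0U, h0V, hφU, hψV, hmap', hmap, hr', hl', ?_, hε₁, hε₂,
    fun x hx => ?_⟩
  · have := hl' 0 h0V
    rwa [hψ0] at this
  · obtain ⟨hcp, hdp⟩ := hVP _ (hmap' hx)
    have hx' := hr' x hx
    set y := φ x with hy
    have hle : l y ≠ 0 := hlne y hdp
    have h1 : x.1 ^ 2 = c y * y.1 ^ 2 := by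
      rw [← hx']; simp only [hψ]; rw [mul_pow, Real.sq_sqrt hcp.le]
    have h2 : x.2 ^ 2 = d y * (y.2 + n y * y.1) ^ 2 := by
      rw [← hx']; simp only [hψ]; rw [mul_pow, Real.sq_sqrt hdp.le]
    have h3 : m y = 2 * (l y * n y) := by simp only [hn]; field_simp
    have h00 : h 0 0 = 0 := by simp [hh]
    rw [h00, hh, h1, h2]
    simp only [hc, hd, Prod.mk.eta]
    rw [h3]
    linear_combination (-(k y - l y * n y * n y) * y.1 ^ 2) * sq₁ -
      (l y * (y.2 + n y * y.1) ^ 2) * sq₂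

/-- A quadratic form with continuous coefficients and diagonal value at the origin having an `A₁`
singularity is nondegenerate. -/
theorem mul_ne_zero_of_hasAkSingAt_one {h : ℝ → ℝ → ℝ} {k m l : ℝ × ℝ → ℝ}
    (hk : Continuous k) (hm : Continuous m) (hl : Continuous l)
    (hh : ∀ u w, h u w = k (u, w) * u ^ 2 + m (u, w) * u * w + l (u, w) * w ^ 2)
    (hm0 : m 0 = 0) (hA : HasAkSingAt h 1) : k 0 * l 0 ≠ 0 := by
  obtain ⟨U, -, φ, -, ε₁, ε₂, hUo, -, h0U, -, hφ, -, -, -, -, -, hφ0, hε₁, hε₂, heq⟩ := hA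
  have h00 : h 0 0 = 0 := by simp [hh]
  have hdiff : DifferentiableAt ℝ φ 0 :=
    (hφ.contDiffAt (hUo.mem_nhds h0U)).differentiableAt (by simp)
  set L := fderiv ℝ φ 0 with hL
  have key : ∀ v : ℝ × ℝ,
      k 0 * (L v).1 ^ 2 + l 0 * (L v).2 ^ 2 = ε₁ * v.1 ^ 2 + ε₂ * v.2 ^ 2 := by
    intro v
    have hline : HasDerivAt (fun t : ℝ => t • v) v 0 := by
      simpa using (hasDerivAt_id (0 : ℝ)).smul_const v
    have hz : HasFDerivAt φ L ((0 : ℝ) • v) := by rw [zero_smul]; exact hdiff.hasFDerivAt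
    have hcurve : HasDerivAt (fun t : ℝ => φ (t • v)) (L v) 0 := hz.comp_hasDerivAt 0 hline
    have hφ0' : φ 0 = 0 := hφ0
    have ht : Tendsto (fun t : ℝ => φ (t • v)) (𝓝[≠] 0) (𝓝 0) := by
      have := hcurve.continuousAt.tendsto.mono_left (nhdsWithin_le_nhds (s := {0}ᶜ))
      simpa [hφ0'] using this
    have hs : Tendsto (fun t : ℝ => t⁻¹ • φ (t • v)) (𝓝[≠] 0) (𝓝 (L v)) := by
      have := hcurve.tendsto_slope_zero
      simpa [hφ0'] using this
    have hs1 := (continuous_fst.tendsto _).comp hs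
    have hs2 := (continuous_snd.tendsto _).comp hs
    have lim := ((((hk.tendsto 0).comp ht).mul (hs1.pow 2)).add
      ((((hm.tendsto 0).comp ht).mul hs1).mul hs2)).add (((hl.tendsto 0).comp ht).mul (hs2.pow 2))
    rw [hm0] at lim
    simp only [zero_mul, add_zero] at lim
    have hU : ∀ᶠ t : ℝ in 𝓝[≠] 0, t • v ∈ U := by
      have hcont : Tendsto (fun t : ℝ => t • v) (𝓝 0) (𝓝 0) := by
        simpa using hline.continuousAt.tendsto
      exact (hcont.mono_left nhdsWithin_le_nhds).eventually (hUo.mem_nhds h0U)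
    refine tendsto_nhds_unique lim (tendsto_const_nhds.congr' ?_)
    filter_upwards [hU, self_mem_nhdsWithin] with t ht1 ht2
    have ht0 : t ≠ 0 := ht2
    have e := heq _ ht1
    rw [h00, hh] at e
    simp only [Prod.mk.eta, Prod.smul_fst, Prod.smul_snd, smul_eq_mul] at e
    simp only [Function.comp_apply, Prod.smul_fst, Prod.smul_snd, smul_eq_mul]
    field_simp
    linear_combination -e
  have k1 := key (1, 0)
  have k2 := key (0, 1)
  have k3 := key (1, 1)
  have hsum : L (1, 1) = L (1, 0) + L (0, 1) := by rw [← map_add]; simp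
  rw [hsum] at k3
  simp only [Prod.fst_add, Prod.snd_add] at k1 k2 k3
  intro h0
  have hcross : k 0 * ((L (1, 0)).1 * (L (0, 1)).1) + l 0 * ((L (1, 0)).2 * (L (0, 1)).2) = 0 := by
    linear_combination (k3 - k1 - k2) / 2
  have hprod : ε₁ * ε₂ = 0 := by
    have e1 : ε₁ = k 0 * (L (1, 0)).1 ^ 2 + l 0 * (L (1, 0)).2 ^ 2 := by rw [k1]; ring
    have e2 : ε₂ = k 0 * (L (0, 1)).1 ^ 2 + l 0 * (L (0, 1)).2 ^ 2 := by rw [k2]; ring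
    rw [e1, e2]
    linear_combination ((L (1, 0)).1 * (L (0, 1)).2 - (L (1, 0)).2 * (L (0, 1)).1) ^ 2 * h0 +
      (k 0 * ((L (1, 0)).1 * (L (0, 1)).1) + l 0 * ((L (1, 0)).2 * (L (0, 1)).2)) * hcross
  rcases hε₁ with rfl | rfl <;> rcases hε₂ with rfl | rfl <;> norm_num at hprod

/-- `h_{ν₀}` has an `A₁` singularity at the origin iff
`y₀ (b₂ y₀ + a_{2,0} z₀) ≠ 0`. -/
theorem height_A1_iff (p q : ℝ → ℝ → ℝ) (b : ℕ → ℝ) (a : ℕ → ℕ → ℝ)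
    (hNF : NormalFormN 4 p q b a) (y₀ z₀ : ℝ)
    (hunit : (0 : ℝ) ^ 2 + y₀ ^ 2 + z₀ ^ 2 = 1) :
    HasAkSingAt (hgt p q (0, y₀, z₀)) 1 ↔ y₀ * (b 2 * y₀ + a 2 0 * z₀) ≠ 0 := by
  obtain ⟨hp, hq, hp0, hq0, hpu, hpw, hqu, hqw, hpww, hpb, hpm, hqa, ha11, ha02⟩ := hNF
  obtain ⟨k, m, l, hk, hm, hl, hpe, hpk, hpm', hpl⟩ := exists_quadratic_form hp hp0 hpu hpw
  obtain ⟨k', m', l', hk', hm', hl', hqe, hqk, hqm, hql⟩ := exists_quadratic_form hq hq0 hqu hqw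
  rw [hpb 2 (by norm_num) (by norm_num)] at hpk
  rw [hpm 1 1 (by norm_num) (by norm_num) (by norm_num) (by norm_num)] at hpm'
  rw [hpww] at hpl
  rw [hqa 2 0 (by norm_num) (by norm_num)] at hqk
  rw [hqa 1 1 (by norm_num) (by norm_num), ha11] at hqm
  rw [hqa 0 2 (by norm_num) (by norm_num), ha02] at hql
  have hK : ContDiff ℝ ∞ fun x => y₀ * k x + z₀ * k' x := by fun_prop
  have hM : ContDiff ℝ ∞ fun x => y₀ * m x + z₀ * m' x := by fun_prop
  have hL : ContDiff ℝ ∞ fun x => y₀ * l x + z₀ * l' x := by fun_prop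
  have hh : ∀ u w, hgt p q (0, y₀, z₀) u w = (y₀ * k (u, w) + z₀ * k' (u, w)) * u ^ 2 +
      (y₀ * m (u, w) + z₀ * m' (u, w)) * u * w + (y₀ * l (u, w) + z₀ * l' (u, w)) * w ^ 2 := by
    intro u w
    simp only [hgt, dot3, gmap, hpe, hqe]
    ring
  have hM0 : y₀ * m 0 + z₀ * m' 0 = 0 := by rw [← hpm', ← hqm]; ring
  have hK0 : b 2 * y₀ + a 2 0 * z₀ = 2 * (y₀ * k 0 + z₀ * k' 0) := by rw [hpk, hqk]; ring
  have hL0 : y₀ = 2 * (y₀ * l 0 + z₀ * l' 0) := by linear_combination y₀ * hpl + z₀ * hql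
  constructor
  · intro hA
    have hne := mul_ne_zero_of_hasAkSingAt_one hK.continuous hM.continuous hL.continuous hh hM0 hA
    have hy : y₀ ≠ 0 := fun h0 => right_ne_zero_of_mul hne (by linarith)
    refine mul_ne_zero hy ?_
    rw [hK0]
    exact mul_ne_zero two_ne_zero (left_ne_zero_of_mul hne)
  · intro hne
    refine hasAkSingAt_one_of_quadratic_form hK hM hL hh hM0 ?_ ?_
    · intro h0
      exact right_ne_zero_of_mul hne (by linarith)
    · intro h0
      exact left_ne_zero_of_mul hne (by linarith)
end
end

section
/- Let g be in normal form and let ν₀ = (0, y₀, z₀) ∈ ℝ³ be a unit vector. Then the height function h_{ν₀} has an A₃ singularity at (0,0) if and only if one of the following holds: (3a) b₂ y₀ + a_{2,0} z₀ = 0, y₀ ≠ 0, b₃ y₀ + a_{3,0} z₀ = 0 and b₄ y₀² + a_{4,0} y₀ z₀ − 3 a_{2,1}² z₀² ≠ 0; or (3b) y₀ = 0, a_{2,0} ≠ 0, a_{0,3} = 0 and a_{2,0} a_{0,4} − 3 a_{1,2}² ≠ 0. -/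
open Real Set

noncomputable section

open Filter Topology in
theorem hasFDerivAt_integral_unitInterval {E F : Type} [NormedAddCommGroup E] [NormedSpace ℝ E]
    [ProperSpace E] [NormedAddCommGroup F] [NormedSpace ℝ F] {f : E × ℝ → F}
    (hf : ContDiff ℝ 1 f) (x₀ : E) :
    HasFDerivAt (fun x => ∫ t in (0 : ℝ)..1, f (x, t))
      (∫ t in (0 : ℝ)..1, (fderiv ℝ f (x₀, t)).comp (ContinuousLinearMap.inl ℝ E ℝ)) x₀ := by
  have hc : Continuous fun z : E × ℝ =>
      (fderiv ℝ f z).comp (ContinuousLinearMap.inl ℝ E ℝ) :=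
    (hf.continuous_fderiv one_ne_zero).clm_comp continuous_const
  obtain ⟨C, hC⟩ := ((isCompact_closedBall x₀ 1).prod (isCompact_Icc (a := (0 : ℝ)) (b := 1))
    ).exists_bound_of_continuousOn hc.continuousOn
  have hpt : ∀ x : E, Continuous fun t : ℝ => (x, t) := fun x => by fun_prop
  refine intervalIntegral.hasFDerivAt_integral_of_dominated_of_fderiv_le
    (F' := fun x t => (fderiv ℝ f (x, t)).comp (ContinuousLinearMap.inl ℝ E ℝ))
    (bound := fun _ => C) (Metric.closedBall_mem_nhds x₀ one_pos) ?_ ?_ ?_ ?_ ?_ ?_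
  · exact Eventually.of_forall fun x => (hf.continuous.comp (hpt x)).aestronglyMeasurable
  · exact (hf.continuous.comp (hpt x₀)).intervalIntegrable _ _
  · exact (hc.comp (hpt x₀)).aestronglyMeasurable
  · refine Eventually.of_forall fun t ht x hx => hC (x, t) ⟨hx, ?_⟩
    rw [uIoc_of_le zero_le_one] at ht
    exact ⟨ht.1.le, ht.2⟩
  · exact intervalIntegrable_const
  · refine Eventually.of_forall fun t _ x _ => ?_
    exact ((hf.differentiable one_ne_zero) (x, t)).hasFDerivAt.comp x (hasFDerivAt_prodMk_left x t)

theorem contDiff_integral_unitInterval {E : Type} [NormedAddCommGroup E] [NormedSpace ℝ E]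
    [ProperSpace E] (n : ℕ) : ∀ {F : Type} [NormedAddCommGroup F] [NormedSpace ℝ F]
    {f : E × ℝ → F}, ContDiff ℝ n f → ContDiff ℝ n fun x => ∫ t in (0 : ℝ)..1, f (x, t) := by
  induction n with
  | zero =>
    intro F _ _ f hf
    exact contDiff_zero.2 (intervalIntegral.continuous_parametric_intervalIntegral_of_continuous'
      (f := fun x t => f (x, t)) hf.continuous 0 1)
  | succ n ih =>
    intro F _ _ f hf
    have h1 : ContDiff ℝ 1 f := hf.of_le (by norm_cast; omega)
    have hd := hasFDerivAt_integral_unitInterval h1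
    push_cast at hf ⊢
    refine contDiff_succ_iff_fderiv.2 ⟨fun x => (hd x).differentiableAt, by simp, ?_⟩
    rw [funext fun x => (hd x).fderiv]
    exact ih (f := fun z => (fderiv ℝ f z).comp (ContinuousLinearMap.inl ℝ E ℝ))
      ((contDiff_succ_iff_fderiv.1 hf).2.2.clm_comp contDiff_const)

/-- Hadamard's lemma with a parameter. -/
theorem exists_contDiff_eq_add_mul {F : ℝ × ℝ → ℝ} (hF : ContDiff ℝ (⊤ : ℕ∞) F) :
    ∃ G : ℝ × ℝ → ℝ, ContDiff ℝ (⊤ : ℕ∞) G ∧ ∀ u v, F (u, v) = F (u, 0) + v * G (u, v) := by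
  have hG : ContDiff ℝ (⊤ : ℕ∞) fun z : (ℝ × ℝ) × ℝ =>
      fderiv ℝ F (z.1.1, z.2 * z.1.2) (0, 1) :=
    ((hF.fderiv_right (m := (⊤ : ℕ∞)) le_rfl).comp (by fun_prop)).clm_apply contDiff_const
  refine ⟨fun x => ∫ t in (0 : ℝ)..1, fderiv ℝ F (x.1, t * x.2) (0, 1), ?_, fun u v => ?_⟩
  · exact contDiff_infty.2 fun n => contDiff_integral_unitInterval n (contDiff_infty.1 hG n)
  · have hd : ∀ t : ℝ, HasDerivAt (fun t : ℝ => F (u, t * v))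
        (v * fderiv ℝ F (u, t * v) (0, 1)) t := by
      intro t
      have h1 : HasDerivAt (fun t : ℝ => (u, t * v)) ((0 : ℝ), 1 * v) t :=
        (hasDerivAt_const t u).prodMk ((hasDerivAt_id t).mul_const v)
      have h2 := ((hF.differentiable (by simp)) (u, t * v)).hasFDerivAt.comp_hasDerivAt t h1
      convert! h2 using 1
      rw [← smul_eq_mul, ← map_smul]
      simp
    have hc : Continuous fun t : ℝ => v * fderiv ℝ F (u, t * v) (0, 1) :=
      continuous_const.mul (hG.continuous.comp (by fun_prop : Continuous fun t : ℝ => ((u, v), t)))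
    have := intervalIntegral.integral_eq_sub_of_hasDerivAt (fun t _ => hd t)
      (hc.intervalIntegrable 0 1)
    rw [intervalIntegral.integral_const_mul] at this
    simp only [one_mul, zero_mul] at this
    simp only
    linarith

theorem exists_contDiff_eventuallyEq {E : Type*} [NormedAddCommGroup E] [NormedSpace ℝ E]
    [HasContDiffBump E] [FiniteDimensional ℝ E] {F : Type*} [NormedAddCommGroup F]
    [NormedSpace ℝ F] {f : E → F} {s : Set E} {x : E}
    (hs : IsOpen s) (hx : x ∈ s) (hf : ContDiffOn ℝ (⊤ : ℕ∞) f s) :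
    ∃ g : E → F, ContDiff ℝ (⊤ : ℕ∞) g ∧ g =ᶠ[nhds x] f := by
  obtain ⟨r, hr, hrs⟩ := Metric.isOpen_iff.1 hs x hx
  let β : ContDiffBump x := ⟨r / 4, r / 2, by positivity, by linarith⟩
  have hsupp : tsupport β ⊆ s := by
    rw [β.tsupport_eq]
    exact (Metric.closedBall_subset_ball (show r / 2 < r by linarith)).trans hrs
  refine ⟨fun y => β y • f y, contDiff_iff_contDiffAt.2 fun y => ?_, ?_⟩
  · by_cases hy : y ∈ s
    · exact β.contDiff.contDiffAt.smul (hf.contDiffAt (hs.mem_nhds hy))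
    · have h0 : (fun y => β y • f y) =ᶠ[nhds y] fun _ => 0 := by
        filter_upwards [(isClosed_tsupport β).isOpen_compl.mem_nhds fun h => hy (hsupp h)] with z hz
        rw [image_eq_zero_of_notMem_tsupport hz, zero_smul]
      exact contDiffAt_const.congr_of_eventuallyEq h0
  · filter_upwards [β.eventuallyEq_one] with y hy
    simp only [hy, Pi.one_apply, one_smul]

theorem exists_contDiffOn_inverse {E : Type*} [NormedAddCommGroup E] [NormedSpace ℝ E]
    [FiniteDimensional ℝ E] {f : E → E} (hf : ContDiff ℝ (⊤ : ℕ∞) f) {x : E}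
    (hinj : Function.Injective (fderiv ℝ f x)) {W : Set E} (hW : W ∈ nhds x) :
    ∃ (U V : Set E) (g : E → E), IsOpen U ∧ IsOpen V ∧ f x ∈ U ∧ x ∈ V ∧ V ⊆ W ∧
      ContDiffOn ℝ (⊤ : ℕ∞) g U ∧ MapsTo g U V ∧ MapsTo f V U ∧ (∀ y ∈ U, f (g y) = y) ∧
      ∀ z ∈ V, g (f z) = z := by
  have : CompleteSpace E := FiniteDimensional.complete ℝ E
  let e₀ : E ≃L[ℝ] E := (LinearEquiv.ofInjectiveEndo (fderiv ℝ f x : E →ₗ[ℝ] E)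
    hinj).toContinuousLinearEquiv
  have he₀ : (e₀ : E →L[ℝ] E) = fderiv ℝ f x := by
    ext y; rfl
  have hd : HasFDerivAt f (e₀ : E →L[ℝ] E) x := by
    rw [he₀]; exact (hf.differentiable (by simp) x).hasFDerivAt
  let Φ := hf.contDiffAt.toOpenPartialHomeomorph f hd (by simp)
  have hΦ : (Φ : E → E) = f := rfl
  have hx : x ∈ Φ.source := hf.contDiffAt.mem_toOpenPartialHomeomorph_source hd (by simp)
  let D : Set E := fderiv ℝ f ⁻¹' range ((↑) : (E ≃L[ℝ] E) → E →L[ℝ] E)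
  have hD : IsOpen D :=
    ContinuousLinearEquiv.isOpen.preimage (hf.continuous_fderiv (by simp))
  have hO : IsOpen (interior W ∩ D) := isOpen_interior.inter hD
  let Ψ := Φ.restrOpen _ hO
  have hΨ : ∀ z, Ψ z = f z := fun _ => rfl
  have hsrc : Ψ.source = Φ.source ∩ (interior W ∩ D) := Φ.restrOpen_source _ hO
  have hxs : x ∈ Ψ.source := by
    rw [hsrc]
    exact ⟨hx, mem_interior_iff_mem_nhds.2 hW, e₀, he₀⟩
  refine ⟨Ψ.target, Ψ.source, Ψ.symm, Ψ.open_target, Ψ.open_source, Ψ.map_source hxs, hxs,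
    ?_, ?_, Ψ.mapsTo_symm, Ψ.mapsTo, fun y hy => Ψ.right_inv hy, fun z hz => Ψ.left_inv hz⟩
  · rw [hsrc]
    exact fun z hz => interior_subset hz.2.1
  · intro y hy
    have hz := Ψ.map_target hy
    rw [hsrc] at hz
    obtain ⟨e, he⟩ := hz.2.2
    refine (Ψ.contDiffAt_symm (f₀' := e) hy ?_ hf.contDiffAt).contDiffWithinAt
    rw [he]
    exact (hf.differentiable (by simp) _).hasFDerivAt

theorem pd_eq_iteratedDeriv (i j : ℕ) (f : ℝ → ℝ → ℝ) (u w : ℝ) :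
    pd i j f u w = iteratedDeriv i (fun s => iteratedDeriv j (f s) w) u := by
  have hw : ∀ j : ℕ, pdw^[j] f = fun u w => iteratedDeriv j (f u) w := by
    intro j
    induction j with
    | zero => simp
    | succ j ih => rw [Function.iterate_succ_apply', ih]; funext u w; simp [pdw, iteratedDeriv_succ]
  have hu : ∀ (i : ℕ) (k : ℝ → ℝ → ℝ), pdu^[i] k = fun u w => iteratedDeriv i (k · w) u := by
    intro i k
    induction i with
    | zero => simp
    | succ i ih => rw [Function.iterate_succ_apply', ih]; funext u w; simp [pdu, iteratedDeriv_succ]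
  rw [pd, hu, hw]

theorem fderiv_uncurry_apply {f : ℝ → ℝ → ℝ} (hf : ContDiff ℝ (⊤ : ℕ∞) fun x : ℝ × ℝ => f x.1 x.2)
    (u w a b : ℝ) :
    fderiv ℝ (fun x : ℝ × ℝ => f x.1 x.2) (u, w) (a, b) = a * pdu f u w + b * pdw f u w := by
  have hd := ((hf.differentiable (by simp)) (u, w)).hasFDerivAt
  have h1 : pdu f u w = fderiv ℝ (fun x : ℝ × ℝ => f x.1 x.2) (u, w) (1, 0) :=
    (HasFDerivAt.comp_hasDerivAt (f := fun t : ℝ => (t, w)) u hd ((hasDerivAt_id u).prodMk (hasDerivAt_const u w))).deriv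
  have h2 : pdw f u w = fderiv ℝ (fun x : ℝ × ℝ => f x.1 x.2) (u, w) (0, 1) :=
    (HasFDerivAt.comp_hasDerivAt (f := fun t : ℝ => (u, t)) w hd ((hasDerivAt_const w u).prodMk (hasDerivAt_id w))).deriv
  rw [h1, h2, ← smul_eq_mul, ← smul_eq_mul, ← map_smul, ← map_smul, ← map_add]
  simp

theorem pdu_eq_fderiv {f : ℝ → ℝ → ℝ} (hf : ContDiff ℝ (⊤ : ℕ∞) fun x : ℝ × ℝ => f x.1 x.2)
    (u w : ℝ) : pdu f u w = fderiv ℝ (fun x : ℝ × ℝ => f x.1 x.2) (u, w) (1, 0) := by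
  simp [fderiv_uncurry_apply hf]

theorem pdw_eq_fderiv {f : ℝ → ℝ → ℝ} (hf : ContDiff ℝ (⊤ : ℕ∞) fun x : ℝ × ℝ => f x.1 x.2)
    (u w : ℝ) : pdw f u w = fderiv ℝ (fun x : ℝ × ℝ => f x.1 x.2) (u, w) (0, 1) := by
  simp [fderiv_uncurry_apply hf]

theorem contDiff_pdu {f : ℝ → ℝ → ℝ} (hf : ContDiff ℝ (⊤ : ℕ∞) fun x : ℝ × ℝ => f x.1 x.2) :
    ContDiff ℝ (⊤ : ℕ∞) fun x : ℝ × ℝ => pdu f x.1 x.2 := by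
  simp only [pdu_eq_fderiv hf]
  exact (hf.fderiv_right le_rfl).clm_apply contDiff_const

theorem contDiff_pdw {f : ℝ → ℝ → ℝ} (hf : ContDiff ℝ (⊤ : ℕ∞) fun x : ℝ × ℝ => f x.1 x.2) :
    ContDiff ℝ (⊤ : ℕ∞) fun x : ℝ × ℝ => pdw f x.1 x.2 := by
  simp only [pdw_eq_fderiv hf]
  exact (hf.fderiv_right le_rfl).clm_apply contDiff_const

theorem pdu_pdw_comm {f : ℝ → ℝ → ℝ} (hf : ContDiff ℝ (⊤ : ℕ∞) fun x : ℝ × ℝ => f x.1 x.2) :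
    pdu (pdw f) = pdw (pdu f) := by
  funext u w
  have hd : DifferentiableAt ℝ (fderiv ℝ fun x : ℝ × ℝ => f x.1 x.2) (u, w) :=
    (hf.fderiv_right (m := (⊤ : ℕ∞)) le_rfl).differentiable (by simp) _
  rw [pdu_eq_fderiv (contDiff_pdw hf), pdw_eq_fderiv (contDiff_pdu hf)]
  simp only [pdu_eq_fderiv hf, pdw_eq_fderiv hf, Prod.mk.eta]
  rw [fderiv_clm_apply hd (by fun_prop), fderiv_clm_apply hd (by fun_prop)]
  simpa using (hf.contDiffAt (x := (u, w))).isSymmSndFDerivAt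
    (by
      rw [minSmoothness_of_isRCLikeNormedField]
      exact WithTop.coe_le_coe.2 (le_top : (2 : ℕ∞) ≤ ⊤)) (1, 0) (0, 1)

theorem pd_linear_combination {f k : ℝ → ℝ → ℝ}
    (hf : ContDiff ℝ (⊤ : ℕ∞) fun x : ℝ × ℝ => f x.1 x.2)
    (hk : ContDiff ℝ (⊤ : ℕ∞) fun x : ℝ × ℝ => k x.1 x.2) (α β : ℝ) (i j : ℕ) :
    pd i j (fun u w => α * f u w + β * k u w) =
      fun u w => α * pd i j f u w + β * pd i j k u w := by
  have hline : ∀ {f : ℝ → ℝ → ℝ}, ContDiff ℝ (⊤ : ℕ∞) (fun x : ℝ × ℝ => f x.1 x.2) →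
      (∀ w, Differentiable ℝ (f · w)) ∧ ∀ u, Differentiable ℝ (f u) := fun h =>
    ⟨fun w => (h.differentiable (by simp)).comp
      (by fun_prop : Differentiable ℝ fun t : ℝ => (t, w)),
     fun u => (h.differentiable (by simp)).comp
      (by fun_prop : Differentiable ℝ fun t : ℝ => (u, t))⟩
  induction i with
  | zero =>
    induction j generalizing f k with
    | zero => rfl
    | succ j ih =>
      have h : pdw (fun u w => α * f u w + β * k u w) =
          fun u w => α * pdw f u w + β * pdw k u w := by
        funext u w
        exact ((((hline hf).2 u w).hasDerivAt.const_mul α).add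
          (((hline hk).2 u w).hasDerivAt.const_mul β)).deriv
      have := ih (contDiff_pdw hf) (contDiff_pdw hk)
      rw [← h] at this
      exact this
  | succ i ih =>
    have hsm : ∀ {f : ℝ → ℝ → ℝ}, ContDiff ℝ (⊤ : ℕ∞) (fun x : ℝ × ℝ => f x.1 x.2) →
        ContDiff ℝ (⊤ : ℕ∞) fun x : ℝ × ℝ => pd i j f x.1 x.2 := by
      intro f hf
      have hw : ContDiff ℝ (⊤ : ℕ∞) fun x : ℝ × ℝ => (pdw^[j] f) x.1 x.2 := by
        clear ih
        induction j with
        | zero => exact hf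
        | succ j ih => rw [Function.iterate_succ_apply']; exact contDiff_pdw ih
      unfold pd
      clear ih
      induction i with
      | zero => exact hw
      | succ i ih => rw [Function.iterate_succ_apply']; exact contDiff_pdu ih
    have hs : ∀ f : ℝ → ℝ → ℝ, pd (i + 1) j f = pdu (pd i j f) := fun f =>
      Function.iterate_succ_apply' pdu i _
    rw [hs, hs, hs, ih]
    funext u w
    exact ((((hline (hsm hf)).1 w u).hasDerivAt.const_mul α).add
      (((hline (hsm hk)).1 w u).hasDerivAt.const_mul β)).deriv

open Filter Topology in
theorem pd_congr {f k : ℝ → ℝ → ℝ} {z : ℝ × ℝ}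
    (h : (fun x : ℝ × ℝ => f x.1 x.2) =ᶠ[𝓝 z] fun x => k x.1 x.2) (i j : ℕ) :
    (fun x : ℝ × ℝ => pd i j f x.1 x.2) =ᶠ[𝓝 z] fun x => pd i j k x.1 x.2 := by
  have hw : ∀ {f k : ℝ → ℝ → ℝ}, (fun x : ℝ × ℝ => f x.1 x.2) =ᶠ[𝓝 z] (fun x => k x.1 x.2) →
      (fun x : ℝ × ℝ => pdw f x.1 x.2) =ᶠ[𝓝 z] fun x => pdw k x.1 x.2 := by
    intro f k h
    filter_upwards [h.eventuallyEq_nhds] with x hx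
    refine EventuallyEq.deriv_eq ?_
    exact ((by fun_prop : Continuous fun t : ℝ => (x.1, t)).tendsto x.2).eventually hx
  have hu : ∀ {f k : ℝ → ℝ → ℝ}, (fun x : ℝ × ℝ => f x.1 x.2) =ᶠ[𝓝 z] (fun x => k x.1 x.2) →
      (fun x : ℝ × ℝ => pdu f x.1 x.2) =ᶠ[𝓝 z] fun x => pdu k x.1 x.2 := by
    intro f k h
    filter_upwards [h.eventuallyEq_nhds] with x hx
    refine EventuallyEq.deriv_eq ?_
    exact ((by fun_prop : Continuous fun t : ℝ => (t, x.2)).tendsto x.1).eventually hx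
  have hj : (fun x : ℝ × ℝ => (pdw^[j] f) x.1 x.2) =ᶠ[𝓝 z] fun x => (pdw^[j] k) x.1 x.2 := by
    induction j with
    | zero => exact h
    | succ j ih => simp only [Function.iterate_succ_apply']; exact hw ih
  unfold pd
  induction i with
  | zero => exact hj
  | succ i ih => simp only [Function.iterate_succ_apply']; exact hu ih

/-- The partial derivatives at the origin of the square of a function vanishing there. -/
theorem pd_mul_self {X : ℝ → ℝ → ℝ} (hX : ContDiff ℝ (⊤ : ℕ∞) fun x : ℝ × ℝ => X x.1 x.2)
    (h0 : X 0 0 = 0) :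
    let S : ℝ → ℝ → ℝ := fun u w => X u w * X u w
    pd 1 0 S 0 0 = 0 ∧ pd 0 1 S 0 0 = 0 ∧
    pd 2 0 S 0 0 = 2 * pd 1 0 X 0 0 ^ 2 ∧
    pd 1 1 S 0 0 = 2 * pd 1 0 X 0 0 * pd 0 1 X 0 0 ∧
    pd 0 2 S 0 0 = 2 * pd 0 1 X 0 0 ^ 2 ∧
    pd 3 0 S 0 0 = 6 * pd 1 0 X 0 0 * pd 2 0 X 0 0 ∧
    pd 2 1 S 0 0 = 2 * (pd 2 0 X 0 0 * pd 0 1 X 0 0 + 2 * pd 1 0 X 0 0 * pd 1 1 X 0 0) ∧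
    pd 4 0 S 0 0 = 6 * pd 2 0 X 0 0 ^ 2 + 8 * pd 1 0 X 0 0 * pd 3 0 X 0 0 := by
  have hx : ContDiff ℝ (⊤ : ℕ∞) fun s => X s 0 :=
    hX.comp (by fun_prop : ContDiff ℝ (⊤ : ℕ∞) fun t : ℝ => (t, (0 : ℝ)))
  have hx' : ContDiff ℝ (⊤ : ℕ∞) fun s => pdw X s 0 :=
    (contDiff_pdw hX).comp (by fun_prop : ContDiff ℝ (⊤ : ℕ∞) fun t : ℝ => (t, (0 : ℝ)))
  have hy : ∀ u, ContDiff ℝ (⊤ : ℕ∞) (X u) := fun u =>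
    hX.comp (by fun_prop : ContDiff ℝ (⊤ : ℕ∞) fun t : ℝ => (u, t))
  have hw : ∀ u, deriv (fun w => X u w * X u w) 0 = 2 * (X u 0 * pdw X u 0) := by
    intro u
    have hd := ((hy u).differentiable (by simp) 0).hasDerivAt
    refine (hd.mul hd).deriv.trans ?_
    rw [pdw]
    ring
  have mul : ∀ (n : ℕ) {f k : ℝ → ℝ}, ContDiff ℝ (⊤ : ℕ∞) f → ContDiff ℝ (⊤ : ℕ∞) k →
      iteratedDeriv n (fun s => f s * k s) 0 = ∑ i ∈ Finset.range (n + 1),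
        n.choose i * iteratedDeriv i f 0 * iteratedDeriv (n - i) k 0 := by
    intro n f k hf hk
    exact iteratedDeriv_mul (hf.contDiffAt.of_le (by exact_mod_cast le_top))
      (hk.contDiffAt.of_le (by exact_mod_cast le_top))
  have e1 : ∀ n, iteratedDeriv n (fun s => 2 * (X s 0 * pdw X s 0)) 0 =
      2 * iteratedDeriv n (fun s => X s 0 * pdw X s 0) 0 := fun n =>
    iteratedDeriv_const_mul_field 2 _
  have e2 : ∀ s, deriv (X s) 0 = pdw X s 0 := fun s => rfl
  intro S
  refine ⟨?_, ?_, ?_, ?_, ?_, ?_, ?_, ?_⟩ <;>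
    simp only [S, pd_eq_iteratedDeriv, iteratedDeriv_zero, iteratedDeriv_one, hw, e1, mul _ hx hx,
      mul _ hx hx', mul _ (hy 0) (hy 0), Finset.sum_range_succ, Finset.sum_range_zero, h0,
      e2] <;>
    simp [h0, e2, Nat.choose] <;> ring

theorem HasAkSingAt.swap {h : ℝ → ℝ → ℝ} {k : ℕ} (H : HasAkSingAt h k) :
    HasAkSingAt (fun u w => h w u) k := by
  obtain ⟨U, V, φ, ψ, ε₁, ε₂, hU, hV, h0U, h0V, hφ, hψ, mφ, mψ, hl, hr, h0, he₁, he₂, hh⟩ := H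
  have hs : ContDiff ℝ (⊤ : ℕ∞) (Prod.swap : ℝ × ℝ → ℝ × ℝ) := contDiff_snd.prodMk contDiff_fst
  exact ⟨U, Prod.swap ⁻¹' V, Prod.swap ∘ φ, ψ ∘ Prod.swap, ε₁, ε₂, hU,
    hV.preimage continuous_swap, h0U, h0V, hs.comp_contDiffOn hφ,
    hψ.comp hs.contDiffOn fun _ h => h, fun x hx => by simpa using mφ hx,
    fun x hx => mψ hx, fun x hx => by simpa using hl x hx,
    fun y hy => by simp [hr y.swap hy], by simp [h0], he₁, he₂, fun x hx => hh x hx⟩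

theorem pd_swap {f : ℝ → ℝ → ℝ} (hf : ContDiff ℝ (⊤ : ℕ∞) fun x : ℝ × ℝ => f x.1 x.2) (i j : ℕ) :
    pd i j (fun u w => f w u) = fun u w => pd j i f w u := by
  have hpd : ∀ {f : ℝ → ℝ → ℝ}, ContDiff ℝ (⊤ : ℕ∞) (fun x : ℝ × ℝ => f x.1 x.2) → ∀ j : ℕ,
      pdw^[j] (pdu f) = pdu (pdw^[j] f) := by
    intro f hf j
    induction j generalizing f with
    | zero => rfl
    | succ j ih =>
      rw [Function.iterate_succ_apply, Function.iterate_succ_apply, ← pdu_pdw_comm hf,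
        ih (contDiff_pdw hf)]
  have hiu : ∀ j i : ℕ, ∀ {f : ℝ → ℝ → ℝ}, ContDiff ℝ (⊤ : ℕ∞) (fun x : ℝ × ℝ => f x.1 x.2) →
      pdw^[j] (pdu^[i] f) = pdu^[i] (pdw^[j] f) := by
    intro j i
    induction i with
    | zero => intros; rfl
    | succ i ih =>
      intro f hf
      rw [Function.iterate_succ_apply, ih (contDiff_pdu hf), hpd hf, ← Function.iterate_succ_apply]
  have hw : ∀ j : ℕ, pdw^[j] (fun u w => f w u) = fun u w => (pdu^[j] f) w u := by
    intro j
    induction j with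
    | zero => rfl
    | succ j ih => rw [Function.iterate_succ_apply', Function.iterate_succ_apply', ih]; rfl
  have hu : ∀ (i : ℕ) (k : ℝ → ℝ → ℝ),
      pdu^[i] (fun u w => k w u) = fun u w => (pdw^[i] k) w u := by
    intro i k
    induction i with
    | zero => rfl
    | succ i ih => rw [Function.iterate_succ_apply', Function.iterate_succ_apply', ih]; rfl
  rw [pd, hw, hu, hiu i j hf]
  rfl

/-- The partial derivatives at the origin of a sum of a square and a remainder. -/
theorem pd_of_eventuallyEq_square_add {h X R : ℝ → ℝ → ℝ} {ε : ℝ}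
    (hX : ContDiff ℝ (⊤ : ℕ∞) fun x : ℝ × ℝ => X x.1 x.2)
    (hR : ContDiff ℝ (⊤ : ℕ∞) fun x : ℝ × ℝ => R x.1 x.2) (h0 : X 0 0 = 0)
    (hh : (fun x : ℝ × ℝ => h x.1 x.2) =ᶠ[nhds (0, 0)]
      fun x => ε * (X x.1 x.2 * X x.1 x.2) + R x.1 x.2) :
    pd 1 0 h 0 0 = pd 1 0 R 0 0 ∧ pd 0 1 h 0 0 = pd 0 1 R 0 0 ∧
    pd 2 0 h 0 0 = ε * (2 * pd 1 0 X 0 0 ^ 2) + pd 2 0 R 0 0 ∧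
    pd 1 1 h 0 0 = ε * (2 * pd 1 0 X 0 0 * pd 0 1 X 0 0) + pd 1 1 R 0 0 ∧
    pd 0 2 h 0 0 = ε * (2 * pd 0 1 X 0 0 ^ 2) + pd 0 2 R 0 0 ∧
    pd 3 0 h 0 0 = ε * (6 * pd 1 0 X 0 0 * pd 2 0 X 0 0) + pd 3 0 R 0 0 ∧
    pd 2 1 h 0 0 = ε * (2 * (pd 2 0 X 0 0 * pd 0 1 X 0 0 + 2 * pd 1 0 X 0 0 * pd 1 1 X 0 0)) +
      pd 2 1 R 0 0 ∧
    pd 4 0 h 0 0 = ε * (6 * pd 2 0 X 0 0 ^ 2 + 8 * pd 1 0 X 0 0 * pd 3 0 X 0 0) +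
      pd 4 0 R 0 0 := by
  have key : ∀ i j, pd i j h 0 0 = ε * pd i j (fun u w => X u w * X u w) 0 0 + pd i j R 0 0 := by
    intro i j
    have h1 := (pd_congr (k := fun u w => ε * (X u w * X u w) + 1 * R u w)
      (by simpa using hh) i j).self_of_nhds
    have h2 := pd_linear_combination (f := fun u w => X u w * X u w) (hX.mul hX) hR ε 1 i j
    simp only [one_mul] at h1 h2
    rw [h2] at h1
    exact h1
  obtain ⟨e1, e2, e3, e4, e5, e6, e7, e8⟩ := pd_mul_self hX h0
  simp only [key, e1, e2, e3, e4, e5, e6, e7, e8]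
  simp

/-- The fourth order jet of `ε₁ X² + ε₂ Y⁴` up to a constant. -/
theorem pd_of_eventuallyEq_square_add_fourth {h X Y : ℝ → ℝ → ℝ} {c ε₁ ε₂ : ℝ}
    (hX : ContDiff ℝ (⊤ : ℕ∞) fun x : ℝ × ℝ => X x.1 x.2)
    (hY : ContDiff ℝ (⊤ : ℕ∞) fun x : ℝ × ℝ => Y x.1 x.2) (hX0 : X 0 0 = 0) (hY0 : Y 0 0 = 0)
    (hh : (fun x : ℝ × ℝ => h x.1 x.2) =ᶠ[nhds (0, 0)]
      fun x => c + ε₁ * X x.1 x.2 ^ 2 + ε₂ * Y x.1 x.2 ^ 4) :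
    pd 2 0 h 0 0 = ε₁ * (2 * pd 1 0 X 0 0 ^ 2) ∧
    pd 1 1 h 0 0 = ε₁ * (2 * pd 1 0 X 0 0 * pd 0 1 X 0 0) ∧
    pd 0 2 h 0 0 = ε₁ * (2 * pd 0 1 X 0 0 ^ 2) ∧
    pd 3 0 h 0 0 = ε₁ * (6 * pd 1 0 X 0 0 * pd 2 0 X 0 0) ∧
    pd 2 1 h 0 0 =
      ε₁ * (2 * (pd 2 0 X 0 0 * pd 0 1 X 0 0 + 2 * pd 1 0 X 0 0 * pd 1 1 X 0 0)) ∧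
    pd 4 0 h 0 0 = ε₁ * (6 * pd 2 0 X 0 0 ^ 2 + 8 * pd 1 0 X 0 0 * pd 3 0 X 0 0) +
      ε₂ * (24 * pd 1 0 Y 0 0 ^ 4) := by
  have hconst : ∀ i j, i + j ≠ 0 → pd i j (fun _ _ => c) 0 0 = 0 := by
    intro i j hij
    rw [pd_eq_iteratedDeriv]
    rcases Nat.eq_zero_or_pos j with rfl | hj
    · simp [iteratedDeriv_const, show i ≠ 0 by omega]
    · simp [iteratedDeriv_const, hj.ne']
  have hS := hY.mul hY
  obtain ⟨-, -, s1, s2, s3, s4, s5, s6⟩ := pd_of_eventuallyEq_square_add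
    (h := fun u w => c + ε₂ * Y u w ^ 4) (X := fun u w => Y u w * Y u w)
    (R := fun _ _ => c) (ε := ε₂) hS contDiff_const (by simp [hY0])
    (Filter.Eventually.of_forall fun x => by simp only; ring)
  obtain ⟨t1, t2, t3, t4, t5, t6, t7, t8⟩ := pd_mul_self hY hY0
  obtain ⟨-, -, r1, r2, r3, r4, r5, r6⟩ := pd_of_eventuallyEq_square_add
    (R := fun u w => c + ε₂ * Y u w ^ 4) (ε := ε₁) hX
    (contDiff_const.add (contDiff_const.mul (hY.pow 4))) hX0
    (hh.trans (Filter.Eventually.of_forall fun x => by simp only; ring))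
  rw [r1, r2, r3, r4, r5, r6, s1, s2, s3, s4, s5, s6]
  simp only [t1, t2, t3, hconst _ _ (show 2 + 0 ≠ 0 by norm_num),
    hconst _ _ (show 0 + 2 ≠ 0 by norm_num), hconst _ _ (show 1 + 1 ≠ 0 by norm_num),
    hconst _ _ (show 3 + 0 ≠ 0 by norm_num), hconst _ _ (show 2 + 1 ≠ 0 by norm_num),
    hconst _ _ (show 4 + 0 ≠ 0 by norm_num)]
  refine ⟨?_, ?_, ?_, ?_, ?_, ?_⟩ <;> ring

theorem HasAkSingAt.exists_coordinates {h : ℝ → ℝ → ℝ} {k : ℕ} (H : HasAkSingAt h k) :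
    ∃ (X Y : ℝ → ℝ → ℝ) (ε₁ ε₂ : ℝ), (ε₁ = 1 ∨ ε₁ = -1) ∧ (ε₂ = 1 ∨ ε₂ = -1) ∧
      ContDiff ℝ (⊤ : ℕ∞) (fun x : ℝ × ℝ => X x.1 x.2) ∧
      ContDiff ℝ (⊤ : ℕ∞) (fun x : ℝ × ℝ => Y x.1 x.2) ∧ X 0 0 = 0 ∧ Y 0 0 = 0 ∧
      pd 1 0 X 0 0 * pd 0 1 Y 0 0 - pd 0 1 X 0 0 * pd 1 0 Y 0 0 ≠ 0 ∧
      (fun x : ℝ × ℝ => h x.1 x.2) =ᶠ[nhds (0, 0)]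
        fun x => h 0 0 + ε₁ * X x.1 x.2 ^ 2 + ε₂ * Y x.1 x.2 ^ (k + 1) := by
  obtain ⟨U, V, φ, ψ, ε₁, ε₂, hU, hV, h0U, h0V, hφ, hψ, mφ, mψ, hl, hr, h0, he₁, he₂, hh⟩ := H
  obtain ⟨Ψ, hΨ, hΨψ⟩ := exists_contDiff_eventuallyEq hV h0V hψ
  have hψ0 : ψ (0, 0) = (0, 0) := by rw [← h0, hl _ h0U, h0]
  have hΨ0 : Ψ (0, 0) = (0, 0) := hΨψ.self_of_nhds.trans hψ0
  have hX : ContDiff ℝ (⊤ : ℕ∞) fun x : ℝ × ℝ => (Ψ (x.1, x.2)).1 := hΨ.fst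
  have hY : ContDiff ℝ (⊤ : ℕ∞) fun x : ℝ × ℝ => (Ψ (x.1, x.2)).2 := hΨ.snd
  have hdΨ : HasFDerivAt Ψ (fderiv ℝ Ψ (0, 0)) (0, 0) :=
    (hΨ.differentiable (by simp) _).hasFDerivAt
  have hinj : ∀ a b, fderiv ℝ Ψ (0, 0) (a, b) = 0 → (a, b) = (0 : ℝ × ℝ) := by
    intro a b hab
    have hdφ := ((hφ.contDiffAt (hU.mem_nhds h0U)).differentiableAt (by simp)).hasFDerivAt
    rw [← hΨ0] at hdφ
    have hc := hdφ.comp (0, 0) hdΨ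
    have hid : φ ∘ Ψ =ᶠ[nhds (0, 0)] id := by
      filter_upwards [hΨψ, hV.mem_nhds h0V] with y hy hyV
      simp [hy, hr y hyV]
    have := (hc.congr_of_eventuallyEq hid.symm).unique (hasFDerivAt_id _)
    have := DFunLike.congr_fun this (a, b)
    simpa [hab] using this.symm
  have hval : ∀ a b, fderiv ℝ Ψ (0, 0) (a, b) =
      (a * pdu (fun u w => (Ψ (u, w)).1) 0 0 + b * pdw (fun u w => (Ψ (u, w)).1) 0 0,
       a * pdu (fun u w => (Ψ (u, w)).2) 0 0 + b * pdw (fun u w => (Ψ (u, w)).2) 0 0) := by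
    intro a b
    rw [← fderiv_uncurry_apply hX, ← fderiv_uncurry_apply hY]
    simp only [Prod.mk.eta]
    rw [hdΨ.fst.fderiv, hdΨ.snd.fderiv]
    rfl
  refine ⟨fun u w => (Ψ (u, w)).1, fun u w => (Ψ (u, w)).2, ε₁, ε₂, he₁, he₂, hX, hY,
    by simp [hΨ0], by simp [hΨ0], ?_, ?_⟩
  · simp only [pd, Function.iterate_zero, Function.iterate_one, id]
    intro hdet
    have k1 := hinj (pdw (fun u w => (Ψ (u, w)).1) 0 0) (-pdu (fun u w => (Ψ (u, w)).1) 0 0)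
      (by rw [hval]; ext <;> simp only [Prod.fst_zero, Prod.snd_zero] <;> linarith)
    have k2 := hinj (pdw (fun u w => (Ψ (u, w)).2) 0 0) (-pdu (fun u w => (Ψ (u, w)).2) 0 0)
      (by rw [hval]; ext <;> simp only [Prod.fst_zero, Prod.snd_zero] <;> linarith)
    simp only [Prod.mk_eq_zero, neg_eq_zero] at k1 k2
    have := hinj 1 0 (by rw [hval]; simp [k1, k2])
    simp at this
  · filter_upwards [hΨψ, hV.mem_nhds h0V] with y hy hyV
    simp only [Prod.mk.eta, hy]
    rw [← hh _ (mψ hyV), hr y hyV]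

theorem HasAkSingAt.jet_of_pd_zero_two_ne_zero {h : ℝ → ℝ → ℝ} (H : HasAkSingAt h 3)
    (h11 : pd 1 1 h 0 0 = 0) (h02 : pd 0 2 h 0 0 ≠ 0) :
    pd 2 0 h 0 0 = 0 ∧ pd 3 0 h 0 0 = 0 ∧
      pd 0 2 h 0 0 * pd 4 0 h 0 0 - 3 * pd 2 1 h 0 0 ^ 2 ≠ 0 := by
  obtain ⟨X, Y, ε₁, ε₂, he₁, he₂, hX, hY, hX0, hY0, hdet, hh⟩ := H.exists_coordinates
  obtain ⟨r1, r2, r3, r4, r5, r6⟩ := pd_of_eventuallyEq_square_add_fourth hX hY hX0 hY0 hh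
  have hε₁ : ε₁ ≠ 0 := by rcases he₁ with rfl | rfl <;> norm_num
  have hε₂ : ε₂ ≠ 0 := by rcases he₂ with rfl | rfl <;> norm_num
  have hXw : pd 0 1 X 0 0 ≠ 0 := by
    intro h'; rw [r3, h'] at h02; simp at h02
  have hXu : pd 1 0 X 0 0 = 0 := by
    rw [r2] at h11; simpa [hε₁, hXw] using h11
  have hYu : pd 1 0 Y 0 0 ≠ 0 := by
    intro h'; rw [hXu, h'] at hdet; simp at hdet
  rw [r1, r3, r4, r5, r6, hXu]
  refine ⟨by simp, by simp, ?_⟩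
  have : ε₁ * (2 * pd 0 1 X 0 0 ^ 2) * (ε₁ * (6 * pd 2 0 X 0 0 ^ 2 + 8 * 0 * pd 3 0 X 0 0) +
      ε₂ * (24 * pd 1 0 Y 0 0 ^ 4)) -
      3 * (ε₁ * (2 * (pd 2 0 X 0 0 * pd 0 1 X 0 0 + 2 * 0 * pd 1 1 X 0 0))) ^ 2 =
      48 * ε₁ * ε₂ * pd 0 1 X 0 0 ^ 2 * pd 1 0 Y 0 0 ^ 4 := by ring
  rw [this]
  positivity

theorem HasAkSingAt.pd_zero_two_ne_zero {h : ℝ → ℝ → ℝ} (H : HasAkSingAt h 3)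
    (h20 : pd 2 0 h 0 0 = 0) : pd 0 2 h 0 0 ≠ 0 := by
  obtain ⟨X, Y, ε₁, ε₂, he₁, he₂, hX, hY, hX0, hY0, hdet, hh⟩ := H.exists_coordinates
  obtain ⟨r1, r2, r3, r4, r5, r6⟩ := pd_of_eventuallyEq_square_add_fourth hX hY hX0 hY0 hh
  have hε₁ : ε₁ ≠ 0 := by rcases he₁ with rfl | rfl <;> norm_num
  intro h02
  rw [r1] at h20
  rw [r3] at h02
  simp only [mul_eq_zero, hε₁, OfNat.ofNat_ne_zero, false_or, ne_eq, not_false_eq_true,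
    pow_eq_zero_iff] at h20 h02
  rw [h20, h02] at hdet
  simp at hdet

theorem iteratedDeriv_succ_of_eq_add_mul {f g : ℝ → ℝ} {c : ℝ} (hg : ContDiff ℝ (⊤ : ℕ∞) g)
    (hf : ∀ v, f v = c + v * g v) (k : ℕ) :
    iteratedDeriv (k + 1) f 0 = (k + 1) * iteratedDeriv k g 0 := by
  have hd : ∀ (k : ℕ) v, HasDerivAt (iteratedDeriv k g) (iteratedDeriv (k + 1) g v) v := by
    intro k v
    rw [iteratedDeriv_succ]
    exact (hg.differentiable_iteratedDeriv k
      (WithTop.coe_lt_coe.2 (ENat.natCast_lt_top k)) v).hasDerivAt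
  have key : ∀ k : ℕ, iteratedDeriv (k + 1) f = fun v =>
      (k + 1) * iteratedDeriv k g v + v * iteratedDeriv (k + 1) g v := by
    intro k
    induction k with
    | zero =>
      funext v
      have h2 := ((hasDerivAt_id v).mul (hd 0 v)).const_add c
      simp only [iteratedDeriv_zero] at h2
      rw [zero_add, iteratedDeriv_one, funext hf]
      refine h2.deriv.trans ?_
      simp
    | succ k ih =>
      funext v
      rw [iteratedDeriv_succ, ih]
      have h2 := ((hd k v).const_mul ((k : ℝ) + 1)).add ((hasDerivAt_id v).mul (hd (k + 1) v))
      refine h2.deriv.trans ?_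
      push_cast
      simp only [id]
      ring
  rw [key]
  simp

theorem exists_contDiff_eq_add_mul_one_variable {f : ℝ → ℝ} (hf : ContDiff ℝ (⊤ : ℕ∞) f) :
    ∃ g : ℝ → ℝ, ContDiff ℝ (⊤ : ℕ∞) g ∧ (∀ v, f v = f 0 + v * g v) ∧
      ∀ k : ℕ, iteratedDeriv (k + 1) f 0 = (k + 1) * iteratedDeriv k g 0 := by
  obtain ⟨G, hG, hfG⟩ := exists_contDiff_eq_add_mul (F := fun x => f x.2) (hf.comp contDiff_snd)
  have hg : ContDiff ℝ (⊤ : ℕ∞) fun v => G (0, v) :=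
    hG.comp (by fun_prop : ContDiff ℝ (⊤ : ℕ∞) fun v : ℝ => ((0 : ℝ), v))
  exact ⟨fun v => G (0, v), hg, hfG 0, iteratedDeriv_succ_of_eq_add_mul hg (hfG 0)⟩

/-- The splitting lemma in the plane. -/
theorem exists_splitting {h : ℝ → ℝ → ℝ}
    (hh : ContDiff ℝ (⊤ : ℕ∞) fun x : ℝ × ℝ => h x.1 x.2)
    (h01 : pd 0 1 h 0 0 = 0) (h02 : pd 0 2 h 0 0 ≠ 0) :
    ∃ (X : ℝ → ℝ → ℝ) (f : ℝ → ℝ) (ε : ℝ), (ε = 1 ∨ ε = -1) ∧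
      ContDiff ℝ (⊤ : ℕ∞) (fun x : ℝ × ℝ => X x.1 x.2) ∧ ContDiff ℝ (⊤ : ℕ∞) f ∧
      X 0 0 = 0 ∧ (fun x : ℝ × ℝ => h x.1 x.2) =ᶠ[nhds (0, 0)]
        fun x => ε * (X x.1 x.2 * X x.1 x.2) + f x.1 := by
  have hw := contDiff_pdw hh
  let Ψ : ℝ × ℝ → ℝ × ℝ := fun x => (x.1, pdw h x.1 x.2)
  have hΨ : ContDiff ℝ (⊤ : ℕ∞) Ψ := contDiff_fst.prodMk hw
  have hinj : Function.Injective (fderiv ℝ Ψ (0, 0)) := by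
    rw [injective_iff_map_eq_zero]
    rintro ⟨a, b⟩ hab
    have hd : HasFDerivAt Ψ _ (0, 0) :=
      hasFDerivAt_fst.prodMk ((hw.differentiable (by simp)) (0, 0)).hasFDerivAt
    rw [hd.fderiv] at hab
    simp only [ContinuousLinearMap.prod_apply, fderiv_uncurry_apply hw, Prod.mk_eq_zero,
      ContinuousLinearMap.coe_fst'] at hab
    obtain ⟨rfl, hb⟩ := hab
    have h02' : pdw (pdw h) 0 0 ≠ 0 := h02
    simpa [h02'] using hb
  have hΨ0 : Ψ (0, 0) = (0, 0) := by
    have : pdw h 0 0 = 0 := h01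
    simp [Ψ, this]
  obtain ⟨U, V, g, hU, -, hxU, h0V, -, hg, -, -, hr, hl⟩ :=
    exists_contDiffOn_inverse hΨ hinj Filter.univ_mem
  rw [hΨ0] at hxU
  have hline : ContDiff ℝ (⊤ : ℕ∞) fun u : ℝ => (u, (0 : ℝ)) := by fun_prop
  have hUo : IsOpen ((fun u : ℝ => (u, (0 : ℝ))) ⁻¹' U) := hU.preimage hline.continuous
  obtain ⟨s, hs, hsg⟩ := exists_contDiff_eventuallyEq (x := (0 : ℝ)) hUo hxU
    ((contDiff_snd (𝕜 := ℝ) (E := ℝ) (F := ℝ)).comp_contDiffOn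
      (hg.comp hline.contDiffOn fun _ h => h))
  have hs0 : s 0 = 0 := by
    rw [hsg.self_of_nhds]
    have := hl _ h0V
    rw [hΨ0] at this
    simp [this]
  have hcrit : ∀ᶠ u in nhds (0 : ℝ), pdw h u (s u) = 0 := by
    filter_upwards [hsg, hUo.mem_nhds hxU] with u hu hmem
    have h1 := hr _ hmem
    simp only [Ψ, Prod.mk.injEq] at h1
    obtain ⟨h1, h2⟩ := h1
    rw [hu]
    simp only [Function.comp_apply]
    nth_rewrite 1 [← h1]
    exact h2
  obtain ⟨G₁, hG₁, hK⟩ := exists_contDiff_eq_add_mul (F := fun x : ℝ × ℝ => h x.1 (s x.1 + x.2))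
    (hh.comp (by fun_prop : ContDiff ℝ (⊤ : ℕ∞) fun x : ℝ × ℝ => (x.1, s x.1 + x.2)))
  obtain ⟨G₂, hG₂, hK₂⟩ := exists_contDiff_eq_add_mul hG₁
  have hlineR : ∀ u : ℝ, ContDiff ℝ (⊤ : ℕ∞) fun v : ℝ => (u, v) := fun u => by fun_prop
  have hG₁0 : ∀ u, G₁ (u, 0) = pdw h u (s u) := by
    intro u
    have hd : HasDerivAt (h u) (pdw h u (s u)) (s u + 0) := by
      rw [add_zero]
      exact ((hh.comp (hlineR u)).differentiable (by simp) (s u)).hasDerivAt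
    have h1 := hd.comp_const_add (s u) 0
    have h2 := (hasDerivAt_id (0 : ℝ)).mul
      (((hG₁.comp (hlineR u)).differentiable (by simp) 0).hasDerivAt)
    have h3 := (h2.const_add (h u (s u + 0))).unique
      (h1.congr_of_eventuallyEq (Filter.Eventually.of_forall fun v => (hK u v).symm))
    simpa using h3
  have hexp : ∀ᶠ u in nhds (0 : ℝ), ∀ w,
      h u w = h u (s u) + (w - s u) ^ 2 * G₂ (u, w - s u) := by
    filter_upwards [hcrit] with u hu w
    have h1 := hK u (w - s u)
    rw [hK₂, hG₁0, hu] at h1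
    simp only [add_sub_cancel, add_zero] at h1
    rw [h1]
    ring
  have hG0 : pd 0 2 h 0 0 = 2 * G₂ (0, 0) := by
    have h0 : ∀ w, h 0 w = h 0 0 + w * (w * G₂ (0, w)) := by
      intro w
      have := hexp.self_of_nhds w
      rw [hs0, sub_zero] at this
      rw [this]
      ring
    have hg := hG₂.comp (hlineR 0)
    rw [pd_eq_iteratedDeriv, iteratedDeriv_zero,
      iteratedDeriv_succ_of_eq_add_mul (contDiff_id.mul hg) h0 1,
      iteratedDeriv_succ_of_eq_add_mul (f := fun v => id v * _) (c := 0) hg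
        (fun v => (zero_add _).symm) 0]
    norm_num
  obtain ⟨ε, hε, hpos⟩ : ∃ ε : ℝ, (ε = 1 ∨ ε = -1) ∧ 0 < ε * G₂ (0, 0) := by
    have : G₂ (0, 0) ≠ 0 := fun h => h02 (by rw [hG0, h, mul_zero])
    rcases this.lt_or_gt with h | h
    · exact ⟨-1, .inr rfl, by linarith⟩
    · exact ⟨1, .inl rfl, by linarith⟩
  have hεε : ε * ε = 1 := by rcases hε with rfl | rfl <;> norm_num
  have hQ : ContDiff ℝ (⊤ : ℕ∞) fun x : ℝ × ℝ => ε * G₂ (x.1, x.2 - s x.1) :=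
    contDiff_const.mul (hG₂.comp
      (by fun_prop : ContDiff ℝ (⊤ : ℕ∞) fun x : ℝ × ℝ => (x.1, x.2 - s x.1)))
  have hO : IsOpen {x : ℝ × ℝ | 0 < ε * G₂ (x.1, x.2 - s x.1)} :=
    isOpen_lt continuous_const hQ.continuous
  have h0O : ((0, 0) : ℝ × ℝ) ∈ {x : ℝ × ℝ | 0 < ε * G₂ (x.1, x.2 - s x.1)} := by
    simpa [hs0] using hpos
  obtain ⟨k, hk, hkQ⟩ := exists_contDiff_eventuallyEq hO h0O
    (hQ.contDiffOn.sqrt fun x hx => (ne_of_gt hx))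
  refine ⟨fun u w => (w - s u) * k (u, w), fun u => h u (s u), ε, hε,
    (by fun_prop : ContDiff ℝ (⊤ : ℕ∞) fun x : ℝ × ℝ => x.2 - s x.1).mul hk,
    hh.comp (by fun_prop : ContDiff ℝ (⊤ : ℕ∞) fun u : ℝ => (u, s u)), by simp [hs0], ?_⟩
  filter_upwards [hkQ, hO.mem_nhds h0O,
    (continuous_fst.tendsto ((0, 0) : ℝ × ℝ)).eventually hexp] with x hx hxO hxe
  have hsq := Real.mul_self_sqrt (le_of_lt hxO)
  simp only [Prod.mk.eta] at hx ⊢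
  rw [hxe x.2, hx]
  linear_combination (-(x.2 - s x.1) ^ 2 * ε) * hsq -
    (x.2 - s x.1) ^ 2 * G₂ (x.1, x.2 - s x.1) * hεε

theorem exists_fourth_power {f : ℝ → ℝ} (hf : ContDiff ℝ (⊤ : ℕ∞) f)
    (h1 : iteratedDeriv 1 f 0 = 0) (h2 : iteratedDeriv 2 f 0 = 0) (h3 : iteratedDeriv 3 f 0 = 0)
    (h4 : iteratedDeriv 4 f 0 ≠ 0) :
    ∃ (y : ℝ → ℝ) (ε : ℝ), (ε = 1 ∨ ε = -1) ∧ ContDiff ℝ (⊤ : ℕ∞) y ∧ y 0 = 0 ∧ deriv y 0 ≠ 0 ∧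
      ∀ᶠ u in nhds 0, f u = f 0 + ε * y u ^ 4 := by
  obtain ⟨g₁, hg₁, e₁, d₁⟩ := exists_contDiff_eq_add_mul_one_variable hf
  obtain ⟨g₂, hg₂, e₂, d₂⟩ := exists_contDiff_eq_add_mul_one_variable hg₁
  obtain ⟨g₃, hg₃, e₃, d₃⟩ := exists_contDiff_eq_add_mul_one_variable hg₂
  obtain ⟨g₄, hg₄, e₄, d₄⟩ := exists_contDiff_eq_add_mul_one_variable hg₃
  rw [d₁ 0] at h1
  rw [d₁ 1, d₂ 0] at h2
  rw [d₁ 2, d₂ 1, d₃ 0] at h3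
  rw [d₁ 3, d₂ 2, d₃ 1, d₄ 0] at h4
  norm_num at h1 h2 h3 h4
  have hfg : ∀ u, f u = f 0 + u ^ 4 * g₄ u := by
    intro u
    rw [e₁, e₂, e₃, e₄, h1, h2, h3]
    ring
  obtain ⟨ε, hε, hpos⟩ : ∃ ε : ℝ, (ε = 1 ∨ ε = -1) ∧ 0 < ε * g₄ 0 := by
    rcases lt_or_gt_of_ne h4 with h | h
    · exact ⟨-1, .inr rfl, by linarith⟩
    · exact ⟨1, .inl rfl, by linarith⟩
  have hεε : ε * ε = 1 := by rcases hε with rfl | rfl <;> norm_num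
  have hQ : ContDiff ℝ (⊤ : ℕ∞) fun u => ε * g₄ u := contDiff_const.mul hg₄
  have hO : IsOpen {u | 0 < ε * g₄ u} := isOpen_lt continuous_const hQ.continuous
  obtain ⟨k, hk, hkQ⟩ := exists_contDiff_eventuallyEq hO hpos
    ((hQ.contDiffOn.sqrt fun x hx => (ne_of_gt hx)).sqrt
      fun x hx => (Real.sqrt_pos.2 hx).ne')
  have hk0 : k 0 ≠ 0 := by
    rw [hkQ.self_of_nhds]
    exact (Real.sqrt_pos.2 (Real.sqrt_pos.2 hpos)).ne'
  refine ⟨fun u => u * k u, ε, hε, contDiff_id.mul hk, by simp, ?_, ?_⟩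
  · have := ((hasDerivAt_id (0 : ℝ)).mul ((hk.differentiable (by simp) 0).hasDerivAt)).deriv
    intro h'
    apply hk0
    have h'' := this.symm.trans h'
    simpa using h''
  · filter_upwards [hkQ, hO.mem_nhds hpos] with u hu huO
    have h5 := Real.sq_sqrt (le_of_lt huO)
    have h6 := Real.sq_sqrt (Real.sqrt_nonneg (ε * g₄ u))
    have h7 : k u ^ 4 = ε * g₄ u := by
      rw [hu, show (4 : ℕ) = 2 * 2 from rfl, pow_mul, h6, h5]
    rw [hfg u, mul_pow, h7]
    linear_combination (-u ^ 4 * g₄ u) * hεε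

theorem hasAkSingAt_three_iff {h : ℝ → ℝ → ℝ}
    (hh : ContDiff ℝ (⊤ : ℕ∞) fun x : ℝ × ℝ => h x.1 x.2)
    (h10 : pd 1 0 h 0 0 = 0) (h01 : pd 0 1 h 0 0 = 0) (h11 : pd 1 1 h 0 0 = 0)
    (h02 : pd 0 2 h 0 0 ≠ 0) :
    HasAkSingAt h 3 ↔ pd 2 0 h 0 0 = 0 ∧ pd 3 0 h 0 0 = 0 ∧
      pd 0 2 h 0 0 * pd 4 0 h 0 0 - 3 * pd 2 1 h 0 0 ^ 2 ≠ 0 := by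
  refine ⟨fun H => H.jet_of_pd_zero_two_ne_zero h11 h02, fun ⟨h20, h30, hne⟩ => ?_⟩
  obtain ⟨X, f, ε₁, he₁, hX, hf, hX0, hXf⟩ := exists_splitting hh h01 h02
  have hε₁ : ε₁ ≠ 0 := by rcases he₁ with rfl | rfl <;> norm_num
  obtain ⟨r10, -, r20, r11, r02, r30, r21, r40⟩ := pd_of_eventuallyEq_square_add
    (R := fun u _ => f u) hX (hf.comp contDiff_fst) hX0 hXf
  have hR : ∀ i j, pd i j (fun u _ => f u) 0 0 = if j = 0 then iteratedDeriv i f 0 else 0 := by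
    intro i j
    rw [pd_eq_iteratedDeriv]
    simp only [iteratedDeriv_const]
    split_ifs <;> simp
  simp only [hR, if_true, OfNat.ofNat_ne_zero, one_ne_zero, if_false, add_zero]
    at r10 r20 r11 r02 r30 r21 r40
  have hXw : pd 0 1 X 0 0 ≠ 0 := by
    intro h'; rw [r02, h'] at h02; simp at h02
  have hXu : pd 1 0 X 0 0 = 0 := by
    rw [r11] at h11; simpa [hε₁, hXw] using h11
  have hf4 : iteratedDeriv 4 f 0 ≠ 0 := by
    intro h'
    apply hne
    rw [r02, r40, r21, h', hXu]
    ring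
  rw [h10] at r10
  rw [h20, hXu] at r20
  rw [h30, hXu] at r30
  obtain ⟨y, ε₂, he₂, hy, hy0, hy', hfy⟩ := exists_fourth_power hf r10.symm
    (by linarith) (by linarith) hf4
  let Ψ : ℝ × ℝ → ℝ × ℝ := fun x => (X x.1 x.2, y x.1)
  have hΨ : ContDiff ℝ (⊤ : ℕ∞) Ψ := hX.prodMk (hy.comp contDiff_fst)
  have hΨ0 : Ψ (0, 0) = (0, 0) := by simp [Ψ, hX0, hy0]
  have hinj : Function.Injective (fderiv ℝ Ψ (0, 0)) := by
    rw [injective_iff_map_eq_zero]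
    rintro ⟨a, b⟩ hab
    have hd : HasFDerivAt Ψ _ (0, 0) :=
      ((hX.differentiable (by simp)) (0, 0)).hasFDerivAt.prodMk
        (((hy.differentiable (by simp)) 0).hasDerivAt.comp_hasFDerivAt ((0, 0) : ℝ × ℝ)
          hasFDerivAt_fst)
    rw [hd.fderiv] at hab
    simp only [ContinuousLinearMap.prod_apply, fderiv_uncurry_apply hX, Prod.mk_eq_zero] at hab
    obtain ⟨ha, hb⟩ := hab
    have ha0 : a = 0 := by simpa [hy'] using hb
    subst ha0
    have hXw' : pdw X 0 0 ≠ 0 := hXw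
    simpa [hXw'] using ha
  have hform : ∀ᶠ x : ℝ × ℝ in nhds (0, 0),
      h x.1 x.2 = h 0 0 + ε₁ * (Ψ x).1 ^ 2 + ε₂ * (Ψ x).2 ^ 4 := by
    have hf0 : h 0 0 = f 0 := by simpa [hX0] using hXf.self_of_nhds
    filter_upwards [hXf, (continuous_fst.tendsto ((0, 0) : ℝ × ℝ)).eventually hfy] with x hx hx'
    rw [hx, hx', hf0]
    ring
  obtain ⟨U, V, φ, hU, hV, h0U, h0V, hVW, hφ, mφ, mΨ, hr, hl⟩ :=
    exists_contDiffOn_inverse hΨ hinj hform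
  refine ⟨U, V, φ, Ψ, ε₁, ε₂, hU, hV, hΨ0 ▸ h0U, h0V, hφ, hΨ.contDiffOn, mφ, mΨ, hr, hl, ?_,
    he₁, he₂, fun x hx => ?_⟩
  · have := hl _ h0V
    rwa [hΨ0] at this
  · have := hVW (mφ hx)
    simp only [mem_ofPred_eq, hr x hx] at this
    exact this

/-- `h_{ν₀}` has an `A₃` singularity at the origin iff (3a) or (3b) holds. -/
theorem height_A3_iff (p q : ℝ → ℝ → ℝ) (b : ℕ → ℝ) (a : ℕ → ℕ → ℝ)
    (hNF : NormalFormN 4 p q b a) (y₀ z₀ : ℝ)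
    (hunit : (0 : ℝ) ^ 2 + y₀ ^ 2 + z₀ ^ 2 = 1) :
    HasAkSingAt (hgt p q (0, y₀, z₀)) 3 ↔
      ((b 2 * y₀ + a 2 0 * z₀ = 0 ∧ y₀ ≠ 0 ∧ b 3 * y₀ + a 3 0 * z₀ = 0 ∧
          b 4 * y₀ ^ 2 + a 4 0 * y₀ * z₀ - 3 * a 2 1 ^ 2 * z₀ ^ 2 ≠ 0) ∨
        (y₀ = 0 ∧ a 2 0 ≠ 0 ∧ a 0 3 = 0 ∧ a 2 0 * a 0 4 - 3 * a 1 2 ^ 2 ≠ 0)) := by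
  obtain ⟨hp, hq, hp0, hq0, p10, p01, q10, q01, p02, hpb, hpz, hqa, a11, a02⟩ := hNF
  have hfun : hgt p q (0, y₀, z₀) = fun u w => y₀ * p u w + z₀ * q u w := by
    funext u w
    simp only [hgt, gmap, dot3]
    ring
  have hh : ContDiff ℝ (⊤ : ℕ∞) fun x : ℝ × ℝ => hgt p q (0, y₀, z₀) x.1 x.2 := by
    rw [hfun]
    exact (contDiff_const.mul hp).add (contDiff_const.mul hq)
  have hpd : ∀ i j, pd i j (hgt p q (0, y₀, z₀)) 0 0 = y₀ * pd i j p 0 0 + z₀ * pd i j q 0 0 := by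
    intro i j
    rw [hfun, pd_linear_combination hp hq]
  have h10 : pd 1 0 (hgt p q (0, y₀, z₀)) 0 0 = 0 := by rw [hpd, p10, q10]; ring
  have h01 : pd 0 1 (hgt p q (0, y₀, z₀)) 0 0 = 0 := by rw [hpd, p01, q01]; ring
  have h11 : pd 1 1 (hgt p q (0, y₀, z₀)) 0 0 = 0 := by
    rw [hpd, hpz 1 1 (by norm_num) (by norm_num) (by norm_num) (by norm_num),
      hqa 1 1 (by norm_num) (by norm_num), a11]
    ring
  have h02 : pd 0 2 (hgt p q (0, y₀, z₀)) 0 0 = y₀ := by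
    rw [hpd, p02, hqa 0 2 (by norm_num) (by norm_num), a02]
    ring
  have h20 : pd 2 0 (hgt p q (0, y₀, z₀)) 0 0 = b 2 * y₀ + a 2 0 * z₀ := by
    rw [hpd, hpb 2 (by norm_num) (by norm_num), hqa 2 0 (by norm_num) (by norm_num)]
    ring
  by_cases hy : y₀ = 0
  · have hz : z₀ ^ 2 = 1 := by rw [hy] at hunit; linarith
    have hz0 : z₀ ≠ 0 := by rintro rfl; norm_num at hz
    have hswap : HasAkSingAt (hgt p q (0, y₀, z₀)) 3 ↔
        HasAkSingAt (fun u w => hgt p q (0, y₀, z₀) w u) 3 := ⟨fun H => H.swap, fun H => H.swap⟩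
    by_cases ha : a 2 0 = 0
    · refine ⟨fun H => (H.pd_zero_two_ne_zero (by rw [h20, hy, ha]; ring) (h02.trans hy)).elim, ?_⟩
      rintro (h | h)
      · exact (h.2.1 hy).elim
      · exact (h.2.1 ha).elim
    · have hq' : ∀ i j, 2 ≤ i + j → i + j ≤ 4 →
          pd i j (hgt p q (0, y₀, z₀)) 0 0 = z₀ * a i j := by
        intro i j hij hij'
        rw [hpd, hqa i j hij hij', hy]
        ring
      rw [hswap, hasAkSingAt_three_iff (h := fun u w => hgt p q (0, y₀, z₀) w u)
        (hh.comp (contDiff_snd.prodMk contDiff_fst))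
        (by simpa only [pd_swap hh] using h01) (by simpa only [pd_swap hh] using h10)
        (by simpa only [pd_swap hh] using h11)
        (by simp only [pd_swap hh]; rw [h20, hy]; simpa using ⟨ha, hz0⟩)]
      simp only [pd_swap hh]
      rw [hq' 0 2 (by norm_num) (by norm_num), hq' 0 3 (by norm_num) (by norm_num),
        hq' 0 4 (by norm_num) (by norm_num), hq' 2 0 (by norm_num) (by norm_num),
        hq' 1 2 (by norm_num) (by norm_num)]
      have e : z₀ * a 2 0 * (z₀ * a 0 4) - 3 * (z₀ * a 1 2) ^ 2 =
          a 2 0 * a 0 4 - 3 * a 1 2 ^ 2 := by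
        linear_combination (a 2 0 * a 0 4 - 3 * a 1 2 ^ 2) * hz
      rw [e]
      simp [a02, hy, hz0, ha]
  · rw [hasAkSingAt_three_iff hh h10 h01 h11 (by rwa [h02]), h02, h20, hpd 3 0, hpd 4 0, hpd 2 1,
      hpb 3 (by norm_num) (by norm_num), hpb 4 (by norm_num) (by norm_num),
      hqa 3 0 (by norm_num) (by norm_num), hqa 4 0 (by norm_num) (by norm_num),
      hqa 2 1 (by norm_num) (by norm_num),
      hpz 2 1 (by norm_num) (by norm_num) (by norm_num) (by norm_num)]
    have e : y₀ * (y₀ * b 4 + z₀ * a 4 0) - 3 * (y₀ * 0 + z₀ * a 2 1) ^ 2 =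
        b 4 * y₀ ^ 2 + a 4 0 * y₀ * z₀ - 3 * a 2 1 ^ 2 * z₀ ^ 2 := by ring
    rw [e, mul_comm y₀ (b 3), mul_comm z₀ (a 3 0)]
    simp [hy]
end
end
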